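/- arXiv:2206.14586 — 5 statements merged into one kernel-verified Lean document; each statement's English description precedes it below -/
import Mathlib

section
/- Let λ>0. There exists a constant C>0, depending only on λ, such that for all x, t₀ ∈ ℝ with |x| ≠ |t₀| and (x,t₀) ≠ (0,0), one has ∫_{-1}^{1} (1+s)(1-s²)^{λ-1} (x²+t₀²-2x t₀ s)^{-(λ+1)} ds ≤ C (x²+t₀²)^{-λ} (|x|-|t₀|)^{-2}. -/
lemma pk_aux (l D c : ℝ) (hl : 0 < l) (hD : 0 < D) (hc : 0 ≤ c) :
    IntervalIntegrable (fun u : ℝ => u ^ (l - 1) * (D + c * u) ^ (-(l + 1))) MeasureTheory.volume 0 2 ∧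
    ∫ u in (0:ℝ)..2, u ^ (l - 1) * (D + c * u) ^ (-(l + 1)) = (l * D)⁻¹ * (2 / (D + c * 2)) ^ l := by
  have hcont : ContinuousOn (fun u : ℝ => (l * D)⁻¹ * (u / (D + c * u)) ^ l) (Set.Icc 0 2) := by
    apply ContinuousOn.mul continuousOn_const
    apply ContinuousOn.rpow_const
    · apply ContinuousOn.div (by fun_prop) (by fun_prop)
      intro u hu
      have := mul_nonneg hc hu.1
      positivity
    · intro u hu
      exact Or.inr hl.le
  have hder : ∀ u ∈ Set.Ioo (0:ℝ) 2, HasDerivAt (fun u : ℝ => (l * D)⁻¹ * (u / (D + c * u)) ^ l)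
      (u ^ (l - 1) * (D + c * u) ^ (-(l + 1))) u := by
    intro u hu
    have hu0 := hu.1
    have hp : 0 < D + c * u := by positivity
    have h1 : HasDerivAt (fun u : ℝ => D + c * u) c u := by
      simpa using ((hasDerivAt_id u).const_mul c).const_add D
    have h2 := (((hasDerivAt_id u).div h1 hp.ne').rpow_const (p := l)
      (Or.inl (by simp; exact ⟨hu0.ne', hp.ne'⟩))).const_mul (l * D)⁻¹
    have h3 : HasDerivAt (fun u : ℝ => (l * D)⁻¹ * (u / (D + c * u)) ^ l)
      ((l * D)⁻¹ * ((1 * (D + c * u) - u * c) / (D + c * u) ^ 2 * l *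
        (u / (D + c * u)) ^ (l - 1))) u := h2
    refine h3.congr_deriv (Eq.symm ?_)
    rw [Real.div_rpow hu0.le hp.le, show -(l+1) = -(l-1) - 2 by ring, Real.rpow_sub hp,
      Real.rpow_neg hp.le]
    have : (D + c * u) ^ (l - 1) ≠ 0 := (Real.rpow_pos_of_pos hp _).ne'
    rw [Real.rpow_two]
    field_simp
    ring
  have hint : IntervalIntegrable (fun u : ℝ => u ^ (l - 1) * (D + c * u) ^ (-(l + 1)))
      MeasureTheory.volume 0 2 := by
    rw [intervalIntegrable_iff_integrableOn_Ioc_of_le (by norm_num)]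
    apply intervalIntegral.integrableOn_deriv_of_nonneg hcont hder
    intro u hu
    have hu0 := hu.1
    positivity
  refine ⟨hint, ?_⟩
  rw [intervalIntegral.integral_eq_sub_of_hasDerivAt_of_le (by norm_num) hcont hder hint]
  simp [Real.zero_rpow hl.ne']

lemma pk_point (l D c A B s : ℝ) (hl : 0 < l) (hD : 0 < D) (hc : c = |B|) (hA : A = D + c)
    (hs : s ∈ Set.Ioo (-1 : ℝ) 1) :
    0 ≤ (1 + s) * (1 - s ^ 2) ^ (l - 1) * (A - B * s) ^ (-(l + 1)) ∧
    (1 + s) * (1 - s ^ 2) ^ (l - 1) * (A - B * s) ^ (-(l + 1)) ≤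
      2 ^ l * ((1 - s) ^ (l - 1) * (D + c * (1 - s)) ^ (-(l + 1)) +
        (1 + s) ^ (l - 1) * (D + c * (1 + s)) ^ (-(l + 1))) := by
  have a1 : 0 < 1 + s := by linarith [hs.1]
  have a2 : 0 < 1 - s := by linarith [hs.2]
  have hc0 : 0 ≤ c := hc ▸ abs_nonneg B
  have e : (1 - s ^ 2) = (1 + s) * (1 - s) := by ring
  have b1 : B ≤ c := hc ▸ le_abs_self B
  have b2 : -c ≤ B := hc ▸ neg_abs_le B
  have p1 : 0 < D + c * (1 - s) := by positivity
  have p2 : 0 < D + c * (1 + s) := by positivity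
  have pA : 0 < A - B * s := by
    rcases le_total 0 s with h | h <;> nlinarith
  have hneg : -(l + 1) ≤ 0 := by linarith
  rw [e, Real.mul_rpow a1.le a2.le]
  refine ⟨by positivity, ?_⟩
  have r1 : (1 + s) * (1 + s) ^ (l - 1) = (1 + s) ^ l := by
    rw [Real.rpow_sub_one a1.ne']; field_simp
  have r2 : (1 - s) * (1 - s) ^ (l - 1) = (1 - s) ^ l := by
    rw [Real.rpow_sub_one a2.ne']; field_simp
  have q1 : (1 + s) ^ l ≤ 2 ^ l := Real.rpow_le_rpow a1.le (by linarith [hs.2]) hl.le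
  have q2 : (1 - s) ^ l ≤ 2 ^ l := Real.rpow_le_rpow a2.le (by linarith [hs.1]) hl.le
  have n1 : 0 ≤ (1 - s) ^ (l - 1) * (D + c * (1 - s)) ^ (-(l + 1)) := by positivity
  have n2 : 0 ≤ (1 + s) ^ (l - 1) * (D + c * (1 + s)) ^ (-(l + 1)) := by positivity
  have n3 : (0:ℝ) ≤ 2 ^ l := by positivity
  rcases le_total 0 s with h | h
  · have k : (A - B * s) ^ (-(l + 1)) ≤ (D + c * (1 - s)) ^ (-(l + 1)) :=
      Real.rpow_le_rpow_of_nonpos p1 (by nlinarith) hneg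
    calc _ = (1 + s) ^ l * ((1 - s) ^ (l - 1) * (A - B * s) ^ (-(l + 1))) := by rw [← r1]; ring
      _ ≤ 2 ^ l * ((1 - s) ^ (l - 1) * (D + c * (1 - s)) ^ (-(l + 1))) := by gcongr
      _ ≤ _ := by gcongr; linarith
  · have k : (A - B * s) ^ (-(l + 1)) ≤ (D + c * (1 + s)) ^ (-(l + 1)) :=
      Real.rpow_le_rpow_of_nonpos p2 (by nlinarith) hneg
    have m : (1 + s) * (1 - s) ^ (l - 1) ≤ 2 ^ l := by
      refine le_trans ?_ q2
      rw [← r2]; gcongr; linarith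
    calc _ = ((1 + s) * (1 - s) ^ (l - 1)) * ((1 + s) ^ (l - 1) * (A - B * s) ^ (-(l + 1))) := by ring
      _ ≤ 2 ^ l * ((1 + s) ^ (l - 1) * (D + c * (1 + s)) ^ (-(l + 1))) := by gcongr
      _ ≤ _ := by gcongr; linarith

/-- For λ>0 there is C>0 (depending only on λ) such that for all
`x, t₀ ∈ ℝ` with `|x| ≠ |t₀|` and `(x,t₀) ≠ (0,0)`,
`∫_{-1}^{1} (1+s)(1-s²)^{λ-1} (x²+t₀²-2x t₀ s)^{-(λ+1)} ds
   ≤ C (x²+t₀²)^{-λ} (|x|-|t₀|)^{-2}`. -/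
theorem poisson_kernel_pointwise_estimate (l : ℝ) (hl : 0 < l) :
    ∃ C : ℝ, 0 < C ∧ ∀ x t₀ : ℝ, |x| ≠ |t₀| → (x, t₀) ≠ (0, 0) →
      (∫ s in Set.Ioo (-1 : ℝ) 1,
          (1 + s) * (1 - s ^ 2) ^ (l - 1) * (x ^ 2 + t₀ ^ 2 - 2 * x * t₀ * s) ^ (-(l + 1)))
        ≤ C * (x ^ 2 + t₀ ^ 2) ^ (-l) / (|x| - |t₀|) ^ 2 := by
  refine ⟨2 ^ l * (2 * (l⁻¹ * 2 ^ l)), by positivity, ?_⟩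
  intro x t hxt _
  have hD : 0 < (|x| - |t|) ^ 2 := by
    have := sub_ne_zero.mpr hxt
    positivity
  obtain ⟨D, hDd⟩ : ∃ D, D = (|x| - |t|) ^ 2 := ⟨_, rfl⟩
  obtain ⟨A, hAd⟩ : ∃ A, A = x ^ 2 + t ^ 2 := ⟨_, rfl⟩
  obtain ⟨B, hBd⟩ : ∃ B, B = 2 * x * t := ⟨_, rfl⟩
  have hA : A = D + |B| := by
    rw [hAd, hDd, hBd, abs_mul, abs_mul, abs_two, ← sq_abs x, ← sq_abs t]; ring
  rw [← hDd] at hD ⊢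
  rw [← hAd, ← hBd]
  obtain ⟨hi, hv⟩ := pk_aux l D |B| hl hD (abs_nonneg B)
  set H : ℝ → ℝ := fun u => u ^ (l - 1) * (D + |B| * u) ^ (-(l + 1)) with hH
  have hi1 : IntervalIntegrable (fun s => H (1 - s)) MeasureTheory.volume (-1) 1 := by
    have := (hi.comp_sub_left 1).symm
    norm_num at this
    exact this
  have hi2 : IntervalIntegrable (fun s => H (1 + s)) MeasureTheory.volume (-1) 1 := by
    have := (hi.comp_add_left 1)
    norm_num at this
    exact this
  have hi3 := (hi1.add hi2).const_mul (2 ^ l)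
  have hle : (∫ s in Set.Ioo (-1 : ℝ) 1,
      (1 + s) * (1 - s ^ 2) ^ (l - 1) * (A - B * s) ^ (-(l + 1))) ≤
      ∫ s in Set.Ioo (-1 : ℝ) 1, 2 ^ l * (H (1 - s) + H (1 + s)) := by
    apply MeasureTheory.integral_mono_of_nonneg
    · filter_upwards [MeasureTheory.ae_restrict_mem measurableSet_Ioo] with s hs
      exact (pk_point l D |B| A B s hl hD rfl hA hs).1
    · exact (intervalIntegrable_iff_integrableOn_Ioo_of_le (by norm_num)).1 hi3
    · filter_upwards [MeasureTheory.ae_restrict_mem measurableSet_Ioo] with s hs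
      exact (pk_point l D |B| A B s hl hD rfl hA hs).2
  refine hle.trans ?_
  rw [← MeasureTheory.integral_Ioc_eq_integral_Ioo,
    ← intervalIntegral.integral_of_le (by norm_num), intervalIntegral.integral_const_mul,
    intervalIntegral.integral_add hi1 hi2, intervalIntegral.integral_comp_sub_left H,
    intervalIntegral.integral_comp_add_left H]
  norm_num only
  have hv' : ∫ u in (0:ℝ)..2, H u = (l * D)⁻¹ * (2 / (D + |B| * 2)) ^ l := hv
  rw [hv', ← two_mul]
  have hA0 : 0 < A := by rw [hA]; positivity
  have hle2 : (2 / (D + |B| * 2)) ^ l ≤ 2 ^ l * A ^ (-l) := by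
    rw [Real.rpow_neg hA0.le, ← div_eq_mul_inv, ← Real.div_rpow (by norm_num) hA0.le]
    apply Real.rpow_le_rpow (by positivity) _ hl.le
    apply div_le_div_of_nonneg_left (by norm_num) hA0
    linarith [abs_nonneg B]
  calc _ ≤ 2 ^ l * (2 * ((l * D)⁻¹ * (2 ^ l * A ^ (-l)))) := by gcongr
    _ = _ := by field_simp
end

section
/- Let c>1 be fixed. There exist constants 0 < C₁ ≤ C₂, depending only on c, such that for all x, t, t', s ∈ ℝ with |s| ≤ 1 and all δ>0 satisfying ||x|-|t|| > cδ and |t-t'| < δ, one has C₁ (x² + t'² - 2x t' s) ≤ x² + t² - 2x t s ≤ C₂ (x² + t'² - 2x t' s). -/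
theorem qf_lower (x t s : ℝ) (hs : |s| ≤ 1) :
    (|x| - |t|) ^ 2 ≤ x ^ 2 + t ^ 2 - 2 * x * t * s := by
  have h : x * t * s ≤ |x| * |t| := by
    calc x * t * s ≤ |x * t * s| := le_abs_self _
      _ = |x| * |t| * |s| := by rw [abs_mul, abs_mul]
      _ ≤ |x| * |t| * 1 := by gcongr
      _ = |x| * |t| := mul_one _
  nlinarith [sq_abs x, sq_abs t]

theorem qf_par (x a b s : ℝ) (hs : |s| ≤ 1) :
    x ^ 2 + a ^ 2 - 2 * x * a * s ≤
      2 * (x ^ 2 + b ^ 2 - 2 * x * b * s) + 2 * (a - b) ^ 2 := by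
  have h := qf_lower x (2 * b - a) s hs
  nlinarith [sq_nonneg (|x| - |2 * b - a|)]

/-- For fixed `c > 1` there are constants `0 < C₁ ≤ C₂` (depending only on `c`)
such that whenever `|s| ≤ 1`, `δ > 0`, `||x|-|t|| > cδ` and `|t-t'| < δ`, one has
`C₁ (x²+t'²-2xt's) ≤ x²+t²-2xts ≤ C₂ (x²+t'²-2xt's)`. -/
theorem quadratic_form_comparison (c : ℝ) (hc : 1 < c) :
    ∃ C₁ C₂ : ℝ, 0 < C₁ ∧ C₁ ≤ C₂ ∧
      ∀ x t t' s δ : ℝ, |s| ≤ 1 → 0 < δ → c * δ < abs (|x| - |t|) → |t - t'| < δ →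
        C₁ * (x ^ 2 + t' ^ 2 - 2 * x * t' * s) ≤ x ^ 2 + t ^ 2 - 2 * x * t * s ∧
        x ^ 2 + t ^ 2 - 2 * x * t * s ≤ C₂ * (x ^ 2 + t' ^ 2 - 2 * x * t' * s) := by
  have hc0 : 0 < c - 1 := by linarith
  have hp : 0 < 2 / (c - 1) ^ 2 := by positivity
  refine ⟨1 / 4, 2 + 2 / (c - 1) ^ 2, by norm_num, by linarith, ?_⟩
  intro x t t' s δ hs hδ h1 h2
  have hd : (t - t') ^ 2 ≤ δ ^ 2 := by
    rw [← sq_abs]; gcongr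
  have l1 := qf_lower x t s hs
  have l2 := qf_lower x t' s hs
  have p1 := qf_par x t t' s hs
  have p2 := qf_par x t' t s hs
  have e1 : δ ^ 2 ≤ (|x| - |t|) ^ 2 := by
    rw [← sq_abs (|x| - |t|)]
    have : δ ≤ abs (|x| - |t|) := by nlinarith
    gcongr
  have e2 : ((c - 1) * δ) ^ 2 ≤ (|x| - |t'|) ^ 2 := by
    rw [← sq_abs (|x| - |t'|)]
    have h3 := abs_abs_sub_abs_le_abs_sub t t'
    have h4 := abs_sub_abs_le_abs_sub (|x| - |t|) (|x| - |t'|)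
    have h5 : abs ((|x| - |t|) - (|x| - |t'|)) = abs (|t| - |t'|) := by
      rw [← abs_neg]; congr 1; ring
    have : (c - 1) * δ ≤ abs (|x| - |t'|) := by linarith
    gcongr
  refine ⟨by nlinarith, ?_⟩
  have e3 : 2 * δ ^ 2 ≤ 2 / (c - 1) ^ 2 * (x ^ 2 + t' ^ 2 - 2 * x * t' * s) := by
    calc 2 * δ ^ 2 = 2 / (c - 1) ^ 2 * ((c - 1) * δ) ^ 2 := by field_simp
      _ ≤ _ := by
        apply mul_le_mul_of_nonneg_left _ hp.le
        linarith
  linarith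
end

section
/- Let λ>0 and c>1. There exists a constant C>0, depending only on λ and c, such that for all x, t, t₀, s ∈ ℝ with |s| ≤ 1, all δ>0 with ||x|-|t₀|| > cδ and |t-t₀| < δ, and all y>0, one has | y (y²+x²+t²-2xts)^{-(λ+1)} - y (y²+x²+t₀²-2x t₀ s)^{-(λ+1)} | ≤ C |t-t₀| (y²+x²+t₀²-2x t₀ s)^{-(λ+1)}. -/
lemma pk_lower (x t s y : ℝ) (hs : |s| ≤ 1) :
    y ^ 2 + (|x| - |t|) ^ 2 ≤ y ^ 2 + x ^ 2 + t ^ 2 - 2 * x * t * s := by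
  have h1 : x * t * s ≤ |x| * |t| := by
    calc x * t * s ≤ |x * t * s| := le_abs_self _
      _ = |x| * |t| * |s| := by rw [abs_mul, abs_mul]
      _ ≤ |x| * |t| * 1 := by gcongr
      _ = _ := mul_one _
  nlinarith [sq_abs x, sq_abs t]

lemma pk_sqrt (x t u s y : ℝ) (hs : |s| ≤ 1) :
    √(y ^ 2 + x ^ 2 + t ^ 2 - 2 * x * t * s) ≤
      √(y ^ 2 + x ^ 2 + u ^ 2 - 2 * x * u * s) + |t - u| := by
  set b := √(y ^ 2 + x ^ 2 + u ^ 2 - 2 * x * u * s) with hb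
  have hb0 : 0 ≤ b := Real.sqrt_nonneg _
  have hB : b ^ 2 = y ^ 2 + x ^ 2 + u ^ 2 - 2 * x * u * s :=
    Real.sq_sqrt (le_trans (by positivity) (pk_lower x u s y hs))
  have hs2 : s ^ 2 ≤ 1 := (sq_le_one_iff_abs_le_one s).2 hs
  have h1 : |u - x * s| ≤ b := by
    refine abs_le_of_sq_le_sq ?_ hb0
    nlinarith [sq_nonneg y, mul_nonneg (sq_nonneg x) (sub_nonneg.2 hs2)]
  apply Real.sqrt_le_iff.2
  refine ⟨by positivity, ?_⟩
  have h2 : (t - u) * (u - x * s) ≤ |t - u| * b := by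
    calc (t - u) * (u - x * s) ≤ |(t - u) * (u - x * s)| := le_abs_self _
      _ = |t - u| * |u - x * s| := abs_mul _ _
      _ ≤ _ := by gcongr
  nlinarith [sq_abs (t - u)]

lemma pk_rpow (q m a b : ℝ) (hq : 0 < q) (hm : 0 < m) (ha : m ≤ a) (hb : m ≤ b) :
    |a ^ (-q) - b ^ (-q)| ≤ q * m ^ (-q - 1) * |a - b| := by
  have := (convex_Ici m).norm_image_sub_le_of_norm_hasDerivWithin_le
    (f := fun x : ℝ => x ^ (-q)) (f' := fun x => -q * x ^ (-q - 1)) (C := q * m ^ (-q - 1))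
    (fun x hx => (Real.hasDerivAt_rpow_const
      (Or.inl (hm.trans_le hx).ne')).hasDerivWithinAt) ?_ (Set.mem_Ici.2 hb) (Set.mem_Ici.2 ha)
  · simpa [Real.norm_eq_abs] using this
  · intro x hx
    have hx0 : 0 < x := hm.trans_le hx
    rw [norm_mul, norm_neg, Real.norm_of_nonneg hq.le, Real.norm_of_nonneg (by positivity)]
    gcongr q * ?_
    exact Real.rpow_le_rpow_of_nonpos hm hx (by linarith)

/-- For λ>0 and c>1 there is C>0 (depending only on λ and c) such that
whenever `|s| ≤ 1`, `δ > 0`, `||x|-|t₀|| > cδ`, `|t-t₀| < δ` and `y > 0`,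
`|y⟨x,t⟩_{y,s}^{-(λ+1)} - y⟨x,t₀⟩_{y,s}^{-(λ+1)}| ≤ C|t-t₀| ⟨x,t₀⟩_{y,s}^{-(λ+1)}`,
where `⟨x,t⟩_{y,s} = y²+x²+t²-2xts`. -/
theorem poisson_kernel_difference_estimate (l c : ℝ) (hl : 0 < l) (hc : 1 < c) :
    ∃ C : ℝ, 0 < C ∧
      ∀ x t t₀ s δ y : ℝ, |s| ≤ 1 → 0 < δ → c * δ < abs (|x| - |t₀|) → |t - t₀| < δ → 0 < y →
        |y * (y ^ 2 + x ^ 2 + t ^ 2 - 2 * x * t * s) ^ (-(l + 1)) -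
            y * (y ^ 2 + x ^ 2 + t₀ ^ 2 - 2 * x * t₀ * s) ^ (-(l + 1))|
          ≤ C * |t - t₀| * (y ^ 2 + x ^ 2 + t₀ ^ 2 - 2 * x * t₀ * s) ^ (-(l + 1)) := by
  have hk : 0 < 1 - 1 / c := by
    rw [sub_pos, div_lt_one (by linarith)]; exact hc
  set k := 1 - 1 / c with hkdef
  refine ⟨(2 * (l + 1)) * k ^ (-(2 * (l + 1)) - 1), by positivity, ?_⟩
  intro x t u s δ y hs hδ hx ht hy
  have hA0 := pk_lower x t s y hs
  have hB0 := pk_lower x u s y hs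
  have h1 := pk_sqrt x t u s y hs
  have h2 := pk_sqrt x u t s y hs
  rw [abs_sub_comm u t] at h2
  set A := y ^ 2 + x ^ 2 + t ^ 2 - 2 * x * t * s
  set B := y ^ 2 + x ^ 2 + u ^ 2 - 2 * x * u * s
  have hA : 0 < A := lt_of_lt_of_le (by positivity) hA0
  have hB : 0 < B := lt_of_lt_of_le (by positivity) hB0
  have hpow : ∀ D : ℝ, 0 < D → D ^ (-(l + 1)) = (√D) ^ (-(2 * (l + 1))) := by
    intro D hD
    rw [Real.sqrt_eq_rpow, ← Real.rpow_mul hD.le]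
    congr 1; ring
  rw [hpow A hA, hpow B hB]
  have hyb : y ≤ √B := Real.le_sqrt_of_sq_le (by nlinarith [sq_nonneg (|x| - |u|)])
  have hxb : abs (|x| - |u|) ≤ √B :=
    Real.le_sqrt_of_sq_le (by rw [sq_abs]; nlinarith [sq_nonneg y])
  set a := √A
  set b := √B
  have hb : 0 < b := Real.sqrt_pos.2 hB
  have hc0 : 0 < c := by linarith
  have hδb : δ ≤ b / c := by rw [le_div_iff₀ hc0]; linarith
  have hkb : k * b = b - b / c := by rw [hkdef]; ring
  have hbc : 0 < b / c := by positivity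
  have key := pk_rpow (2 * (l + 1)) (k * b) a b (by linarith) (by positivity)
    (by linarith) (by linarith)
  have hab : |a - b| ≤ |t - u| := abs_le.2 ⟨by linarith, by linarith⟩
  rw [← mul_sub, abs_mul, abs_of_pos hy]
  rw [Real.mul_rpow hk.le hb.le] at key
  have hbp : b * b ^ (-(2 * (l + 1)) - 1) = b ^ (-(2 * (l + 1))) := by
    rw [Real.rpow_sub_one hb.ne']; field_simp
  calc y * |a ^ (-(2 * (l + 1))) - b ^ (-(2 * (l + 1)))|
      ≤ b * (2 * (l + 1) * (k ^ (-(2 * (l + 1)) - 1) * b ^ (-(2 * (l + 1)) - 1)) * |t - u|) := by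
        refine mul_le_mul hyb (key.trans ?_) (abs_nonneg _) hb.le
        gcongr
    _ = 2 * (l + 1) * k ^ (-(2 * (l + 1)) - 1) * |t - u| *
          (b * b ^ (-(2 * (l + 1)) - 1)) := by ring
    _ = _ := by rw [hbp]
end

section
/- Let λ>0. For every y>0 and every ξ ∈ ℝ, c_λ ∫_ℝ m_λ y (y²+x²)^{-(λ+1)} E_λ(-ixξ) |x|^{2λ} dx = e^{-y|ξ|}, where m_λ = 2^{λ+1/2}Γ(λ+1)/√π. Equivalently, the Dunkl transform of the λ-Poisson kernel P_y(x) = m_λ y (y²+x²)^{-(λ+1)} is (F_λ P_y)(ξ) = e^{-y|ξ|}. -/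
open MeasureTheory

/-- The normalizing constant `c'_λ = Γ(λ+1/2)/(Γ(λ)Γ(1/2))`. -/
noncomputable def cPrime (l : ℝ) : ℝ :=
  Real.Gamma (l + 1/2) / (Real.Gamma l * Real.Gamma (1/2))

/-- The Dunkl kernel via its Laplace-type representation: for `w = iz`,
`Ek l w = E_λ(iz) = c'_λ ∫_{-1}^1 e^{izt}(1+t)(1-t²)^{λ-1} dt`. -/
noncomputable def Ek (l : ℝ) (w : ℂ) : ℂ :=
  (cPrime l : ℂ) *
    ∫ t in Set.Ioo (-1 : ℝ) 1,
      Complex.exp (w * (t : ℂ)) * (((1 + t) * (1 - t ^ 2) ^ (l - 1) : ℝ) : ℂ)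

/-- `c_λ = (2^{λ+1/2} Γ(λ+1/2))⁻¹`. -/
noncomputable def cLam (l : ℝ) : ℝ := ((2 : ℝ) ^ (l + 1/2) * Real.Gamma (l + 1/2))⁻¹

/-- `m_λ = 2^{λ+1/2} Γ(λ+1)/√π`. -/
noncomputable def mLam (l : ℝ) : ℝ :=
  (2 : ℝ) ^ (l + 1/2) * Real.Gamma (l + 1) / Real.sqrt Real.pi


lemma cauchy_fourier (y ξ : ℝ) (hy : 0 < y) :
    ∫ u : ℝ, Complex.exp (-(Complex.I * ξ * u)) * (((u ^ 2 + y ^ 2)⁻¹ : ℝ) : ℂ)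
      = ((Real.pi / y * Real.exp (-(y * |ξ|)) : ℝ) : ℂ) := by
  have hint : ∀ a : ℝ, IntegrableOn (fun x : ℝ => Complex.exp ((y + a * Complex.I) * x)) (Set.Iic 0) ∧
     IntegrableOn (fun x : ℝ => Complex.exp ((-y + a * Complex.I) * x)) (Set.Ioi 0) := fun a =>
    ⟨integrableOn_exp_mul_complex_Iic (by simpa using hy) 0,
      integrableOn_exp_mul_complex_Ioi (by simpa using hy) 0⟩
  let f : ℝ → ℂ := fun x => ((Real.exp (-(y * |x|)) : ℝ) : ℂ)
  have e1 : ∀ a : ℝ, Set.EqOn (fun x : ℝ => Complex.exp ((y + a * Complex.I) * x))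
      (fun x => Complex.exp (a * x * Complex.I) * f x) (Set.Iic 0) := by
    intro a x hx
    have : |x| = -x := abs_of_nonpos hx
    simp only [f, this, Complex.ofReal_exp, ← Complex.exp_add]
    congr 1; push_cast; ring
  have e2 : ∀ a : ℝ, Set.EqOn (fun x : ℝ => Complex.exp ((-y + a * Complex.I) * x))
      (fun x => Complex.exp (a * x * Complex.I) * f x) (Set.Ioi 0) := by
    intro a x hx
    have : |x| = x := abs_of_pos hx
    simp only [f, this, Complex.ofReal_exp, ← Complex.exp_add]
    congr 1; push_cast; ring
  have i1 : ∀ a : ℝ, IntegrableOn (fun x : ℝ => Complex.exp (a * x * Complex.I) * f x) (Set.Iic 0) :=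
    fun a => (hint a).1.congr_fun (e1 a) measurableSet_Iic
  have i2 : ∀ a : ℝ, IntegrableOn (fun x : ℝ => Complex.exp (a * x * Complex.I) * f x) (Set.Ioi 0) :=
    fun a => (hint a).2.congr_fun (e2 a) measurableSet_Ioi
  have hfi : Integrable f := by
    have := (i1 0).union (i2 0)
    simpa [Set.Iic_union_Ioi] using this
  have hval : ∀ a : ℝ, ∫ x : ℝ, Complex.exp (a * x * Complex.I) * f x
      = (((2 * y) * (a ^ 2 + y ^ 2)⁻¹ : ℝ) : ℂ) := by
    intro a
    rw [← intervalIntegral.integral_Iic_add_Ioi (i1 a) (i2 a),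
      ← setIntegral_congr_fun measurableSet_Iic (e1 a),
      ← setIntegral_congr_fun measurableSet_Ioi (e2 a),
      integral_exp_mul_complex_Iic (by simpa using hy) 0,
      integral_exp_mul_complex_Ioi (by simpa using hy) 0]
    have h1 : (y + a * Complex.I : ℂ) ≠ 0 := by
      intro h; have := congrArg Complex.re h; simp at this; linarith
    have h2 : (-y + a * Complex.I : ℂ) ≠ 0 := by
      intro h; have := congrArg Complex.re h; simp at this; linarith
    have h3 : ((a:ℂ) ^ 2 + y ^ 2 : ℂ) ≠ 0 := by
      have : a ^ 2 + y ^ 2 ≠ 0 := by positivity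
      exact_mod_cast this
    push_cast
    simp only [mul_zero, Complex.exp_zero]
    field_simp
    linear_combination (-2 * (y:ℂ) * a ^ 2) * Complex.I_sq
  have hF : FourierTransform.fourier f = fun w : ℝ => (((2 * y) * ((2 * Real.pi * w) ^ 2 + y ^ 2)⁻¹ : ℝ) : ℂ) := by
    ext w
    rw [Real.fourier_real_eq_integral_exp_smul]
    have := hval (-2 * Real.pi * w)
    rw [show (-2 * Real.pi * w) ^ 2 = (2 * Real.pi * w) ^ 2 by ring] at this
    rw [← this]
    congr 1; ext x
    rw [smul_eq_mul]
    congr 2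
    push_cast; ring
  have hc : Continuous f := by fun_prop
  have hci : Integrable (fun u : ℝ => (u ^ 2 + y ^ 2)⁻¹) := by
    have := (integrable_inv_one_add_sq.comp_mul_left' (R := y⁻¹) (by positivity)).const_mul (y ^ 2)⁻¹
    refine this.congr (Filter.Eventually.of_forall fun u => ?_)
    simp only
    rw [← mul_inv]; congr 1; field_simp; ring
  have hFi : Integrable (FourierTransform.fourier f) := by
    rw [hF]
    exact ((hci.comp_mul_left' (R := 2 * Real.pi) (by positivity)).const_mul (2 * y)).ofReal
  have key := congrFun (hc.fourierInv_fourier_eq hfi hFi) (-ξ)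
  rw [Real.fourierInv_eq', hF] at key
  have h2 := Measure.integral_comp_mul_left (fun u : ℝ => Complex.exp (-(Complex.I * ξ * u)) * (((2 * y) * (u ^ 2 + y ^ 2)⁻¹ : ℝ) : ℂ)) (2 * Real.pi)
  have h3 : (fun v : ℝ => Complex.exp (↑(2 * Real.pi * inner ℝ v (-ξ)) * Complex.I) • (((2 * y) * ((2 * Real.pi * v) ^ 2 + y ^ 2)⁻¹ : ℝ) : ℂ)) = fun x : ℝ => (fun u : ℝ => Complex.exp (-(Complex.I * ξ * u)) * (((2 * y) * (u ^ 2 + y ^ 2)⁻¹ : ℝ) : ℂ)) (2 * Real.pi * x) := by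
    ext v
    simp only [smul_eq_mul]
    congr 2
    simp; ring
  rw [h3, h2] at key
  have h4 : (fun u : ℝ => Complex.exp (-(Complex.I * ξ * u)) * (((2 * y) * (u ^ 2 + y ^ 2)⁻¹ : ℝ) : ℂ))
    = fun u : ℝ => (2 * y : ℂ) * (Complex.exp (-(Complex.I * ξ * u)) * (((u ^ 2 + y ^ 2)⁻¹ : ℝ) : ℂ)) := by
    ext u; push_cast; ring
  rw [h4, integral_const_mul, abs_of_pos (by positivity)] at key
  simp only [f, abs_neg] at key
  rw [Complex.ofReal_mul, ← key, Complex.real_smul]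
  have : (y:ℂ) ≠ 0 := by exact_mod_cast hy.ne'
  have : (Real.pi:ℂ) ≠ 0 := by exact_mod_cast Real.pi_ne_zero
  push_cast
  field_simp

/-- radial density -/
noncomputable def hden (l y u x : ℝ) : ℝ := x * (x ^ 2 - u ^ 2) ^ (l - 1) * (y ^ 2 + x ^ 2) ^ (-(l + 1))

lemma hden_Ioi (l y u : ℝ) (hl : 0 < l) (hy : 0 < y) :
    IntegrableOn (hden l y u) (Set.Ioi |u|) ∧
    ∫ x in Set.Ioi |u|, hden l y u x = (2 * l)⁻¹ * (u ^ 2 + y ^ 2)⁻¹ := by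
  let F : ℝ → ℝ := fun x => (2 * l)⁻¹ * (u ^ 2 + y ^ 2)⁻¹ * ((x ^ 2 - u ^ 2) / (y ^ 2 + x ^ 2)) ^ l
  have hpos : ∀ x ∈ Set.Ioi |u|, 0 < x ∧ 0 < x ^ 2 - u ^ 2 := by
    intro x hx
    have hx' : |u| < x := hx
    have h0 : 0 < x := lt_of_le_of_lt (abs_nonneg u) hx'
    refine ⟨h0, ?_⟩
    have := sq_lt_sq' (by linarith [abs_nonneg u]) hx'
    rw [sq_abs] at this; linarith
  have hcont : ContinuousWithinAt F (Set.Ici |u|) |u| := by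
    apply ContinuousAt.continuousWithinAt
    have : ContinuousAt (fun x : ℝ => (x ^ 2 - u ^ 2) / (y ^ 2 + x ^ 2)) |u| :=
      ContinuousAt.div (by fun_prop) (by fun_prop) (by positivity)
    exact (this.rpow_const (Or.inr hl.le)).const_mul _
  have hderiv : ∀ x ∈ Set.Ioi |u|, HasDerivAt F (hden l y u x) x := by
    intro x hx
    obtain ⟨h0, h1⟩ := hpos x hx
    have hB : 0 < y ^ 2 + x ^ 2 := by positivity
    have d1 : HasDerivAt (fun x : ℝ => x ^ 2 - u ^ 2) (2 * x) x := by
      simpa using (hasDerivAt_pow 2 x).sub_const (u ^ 2)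
    have d2 : HasDerivAt (fun x : ℝ => y ^ 2 + x ^ 2) (2 * x) x := by
      simpa using (hasDerivAt_pow 2 x).const_add (y ^ 2)
    have d3 := ((d1.div d2 hB.ne').rpow_const (p := l) (Or.inl (by simp only [Pi.div_apply]; positivity))).const_mul ((2 * l)⁻¹ * (u ^ 2 + y ^ 2)⁻¹)
    refine d3.congr_deriv ?_
    simp only [Pi.div_apply, hden]
    rw [Real.div_rpow h1.le hB.le, Real.rpow_neg hB.le,
      show l + 1 = (l - 1) + 2 by ring, Real.rpow_add hB, Real.rpow_two]
    have : 0 < (y ^ 2 + x ^ 2) ^ (l - 1) := by positivity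
    have : u ^ 2 + y ^ 2 ≠ 0 := by positivity
    field_simp
    ring
  have hnn : ∀ x ∈ Set.Ioi |u|, 0 ≤ hden l y u x := by
    intro x hx
    obtain ⟨h0, h1⟩ := hpos x hx
    unfold hden; positivity
  have hlim : Filter.Tendsto F Filter.atTop (nhds ((2 * l)⁻¹ * (u ^ 2 + y ^ 2)⁻¹)) := by
    have t1 : Filter.Tendsto (fun x : ℝ => 1 - (u ^ 2 + y ^ 2) / (y ^ 2 + x ^ 2)) Filter.atTop (nhds (1 - 0)) := by
      refine tendsto_const_nhds.sub (Filter.Tendsto.const_div_atTop ?_ _)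
      exact Filter.tendsto_atTop_add_const_left _ _ (Filter.tendsto_pow_atTop two_ne_zero)
    have t2 := (t1.rpow_const (p := l) (Or.inr hl.le)).const_mul ((2 * l)⁻¹ * (u ^ 2 + y ^ 2)⁻¹)
    rw [sub_zero, Real.one_rpow, mul_one] at t2
    refine t2.congr fun x => ?_
    have : y ^ 2 + x ^ 2 ≠ 0 := by positivity
    simp only [F]
    congr 2
    field_simp; ring
  refine ⟨integrableOn_Ioi_deriv_of_nonneg hcont hderiv hnn hlim, ?_⟩
  rw [integral_Ioi_of_hasDerivAt_of_nonneg hcont hderiv hnn hlim]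
  simp [F, Real.zero_rpow hl.ne']

/-- even extension -/
noncomputable def gden (l y u x : ℝ) : ℝ := (Set.Ioi |u|).indicator (hden l y u) |x|

lemma gden_nonneg (l y u x : ℝ) (hy : 0 < y) : 0 ≤ gden l y u x := by
  unfold gden
  refine Set.indicator_nonneg (fun z hz => ?_) _
  have hz' : |u| < z := hz
  have h0 : 0 < z := lt_of_le_of_lt (abs_nonneg u) hz'
  have := sq_lt_sq' (by linarith [abs_nonneg u]) hz'
  rw [sq_abs] at this
  have : 0 < z ^ 2 - u ^ 2 := by linarith
  unfold hden; positivity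

lemma gden_int (l y u : ℝ) (hl : 0 < l) (hy : 0 < y) :
    Integrable (gden l y u) ∧ ∫ x, gden l y u x = l⁻¹ * (u ^ 2 + y ^ 2)⁻¹ := by
  obtain ⟨h1, h2⟩ := hden_Ioi l y u hl hy
  have h3 : Integrable ((Set.Ioi |u|).indicator (hden l y u)) :=
    (integrable_indicator_iff measurableSet_Ioi).2 h1
  have i2 : IntegrableOn (gden l y u) (Set.Ioi 0) := by
    refine (h3.integrableOn (s := Set.Ioi 0)).congr_fun (fun x hx => ?_) measurableSet_Ioi
    simp [gden, abs_of_pos (show 0 < x from hx)]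
  have i1 : IntegrableOn (gden l y u) (Set.Iic 0) := by
    rw [integrableOn_Iic_iff_integrableOn_Iio]
    have := (h3.comp_neg).integrableOn (s := Set.Iio 0)
    refine this.congr_fun (fun x hx => ?_) measurableSet_Iio
    simp [gden, abs_of_neg (show x < 0 from hx)]
  refine ⟨?_, ?_⟩
  · have := i1.union i2
    simpa [Set.Iic_union_Ioi] using this
  · have : ∫ x, gden l y u x = 2 * ∫ x in Set.Ioi (0:ℝ), (Set.Ioi |u|).indicator (hden l y u) x :=
      integral_comp_abs
    rw [this, setIntegral_indicator measurableSet_Ioi, Set.Ioi_inter_Ioi,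
      sup_eq_right.2 (abs_nonneg u), h2]
    field_simp

lemma gden_meas (l y : ℝ) : Measurable (fun p : ℝ × ℝ => gden l y p.2 p.1) := by
  have : (fun p : ℝ × ℝ => gden l y p.2 p.1)
      = fun p : ℝ × ℝ => Set.indicator {q : ℝ × ℝ | |q.2| < |q.1|} (fun q => hden l y q.2 |q.1|) p := by
    ext p
    by_cases h : |p.2| < |p.1| <;> simp [gden, h]
  rw [this]
  refine Measurable.indicator ?_ (measurableSet_lt (by fun_prop) (by fun_prop))
  unfold hden
  have m1 : Measurable (fun q : ℝ × ℝ => (|q.1| ^ 2 - q.2 ^ 2) ^ (l - 1)) :=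
    Measurable.pow_const (by fun_prop) _
  have m2 : Measurable (fun q : ℝ × ℝ => (y ^ 2 + |q.1| ^ 2) ^ (-(l + 1))) :=
    Measurable.pow_const (by fun_prop) _
  exact (Measurable.mul (by fun_prop) m1).mul m2

lemma cauchy_integrable (y : ℝ) (hy : 0 < y) : Integrable (fun u : ℝ => (u ^ 2 + y ^ 2)⁻¹) := by
  have := (integrable_inv_one_add_sq.comp_mul_left' (R := y⁻¹) (by positivity)).const_mul (y ^ 2)⁻¹
  refine this.congr (Filter.Eventually.of_forall fun u => ?_)
  simp only
  rw [← mul_inv]; congr 1; field_simp; ring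

lemma gden_prod (l y : ℝ) (hl : 0 < l) (hy : 0 < y) :
    Integrable (fun p : ℝ × ℝ => gden l y p.2 p.1) (volume.prod volume) := by
  rw [integrable_prod_iff' (gden_meas l y).aestronglyMeasurable]
  refine ⟨Filter.Eventually.of_forall fun u => (gden_int l y u hl hy).1, ?_⟩
  have : (fun u : ℝ => ∫ x, ‖gden l y u x‖) = fun u => l⁻¹ * (u ^ 2 + y ^ 2)⁻¹ := by
    ext u
    rw [← (gden_int l y u hl hy).2]
    congr 1; ext x
    exact Real.norm_of_nonneg (gden_nonneg l y u x hy)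
  simp only [this]
  exact (cauchy_integrable y hy).const_mul _

lemma odd_bound (l y u x : ℝ) (hy : 0 < y) : ‖u / x * gden l y u x‖ ≤ gden l y u x := by
  by_cases h : |u| < |x|
  · have h0 := gden_nonneg l y u x hy
    rw [norm_mul, Real.norm_of_nonneg h0, Real.norm_eq_abs, abs_div]
    exact mul_le_of_le_one_left h0 (div_le_one_of_le₀ h.le (abs_nonneg x))
  · simp [gden, h]

noncomputable def Phi (l y ξ x u : ℝ) : ℂ :=
  Complex.exp (-(Complex.I * ξ * u)) * ((gden l y u x + u / x * gden l y u x : ℝ) : ℂ)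

lemma Phi_int (l y ξ : ℝ) (hl : 0 < l) (hy : 0 < y) :
    Integrable (Function.uncurry (Phi l y ξ)) (volume.prod volume) := by
  have hg := gden_prod l y hl hy
  have m2 : Measurable (fun p : ℝ × ℝ => p.2 / p.1 * gden l y p.2 p.1) :=
    (measurable_snd.div measurable_fst).mul (gden_meas l y)
  have h2 : Integrable (fun p : ℝ × ℝ => p.2 / p.1 * gden l y p.2 p.1) (volume.prod volume) :=
    hg.mono' m2.aestronglyMeasurable
      (Filter.Eventually.of_forall fun p => odd_bound l y p.2 p.1 hy)
  refine Integrable.bdd_mul (c := 1) (hg.add h2).ofReal ?_ ?_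
  · exact Continuous.aestronglyMeasurable (by fun_prop)
  · refine Filter.Eventually.of_forall fun p => ?_
    rw [Complex.norm_exp]; simp

lemma Phi_x (l y ξ u : ℝ) (hl : 0 < l) (hy : 0 < y) :
    ∫ x, Phi l y ξ x u
      = (l : ℂ)⁻¹ * (Complex.exp (-(Complex.I * ξ * u)) * (((u ^ 2 + y ^ 2)⁻¹ : ℝ) : ℂ)) := by
  obtain ⟨h1, h2⟩ := gden_int l y u hl hy
  have m2 : AEStronglyMeasurable (fun x => u / x * gden l y u x) volume :=
    (Measurable.aestronglyMeasurable (by fun_prop)).mul h1.aestronglyMeasurable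
  have i2 : Integrable (fun x => u / x * gden l y u x) :=
    h1.mono' m2 (Filter.Eventually.of_forall fun x => odd_bound l y u x hy)
  have z : ∫ x, u / x * gden l y u x = 0 := by
    have h := integral_neg_eq_self (fun x => u / x * gden l y u x) volume
    have : (fun x => u / -x * gden l y u (-x)) = fun x => -(u / x * gden l y u x) := by
      ext x; simp [gden, div_neg]
    rw [this, integral_neg] at h
    linarith
  unfold Phi
  rw [integral_const_mul, integral_complex_ofReal, integral_add h1 i2, z, h2]
  push_cast; ring

lemma Phi_u (l y ξ x : ℝ) (hx : x ≠ 0) :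
    ∫ u, Phi l y ξ x u = (((y ^ 2 + x ^ 2) ^ (-(l + 1)) * |x| ^ (2 * l) : ℝ) : ℂ) *
      ∫ t in Set.Ioo (-1 : ℝ) 1,
        Complex.exp (-(Complex.I * (x : ℂ) * (ξ : ℂ)) * (t : ℂ)) *
          (((1 + t) * (1 - t ^ 2) ^ (l - 1) : ℝ) : ℂ) := by
  have hxp : 0 < |x| := abs_pos.2 hx
  have h := Measure.integral_comp_mul_left (Phi l y ξ x) x
  have h' : ∫ u, Phi l y ξ x u = ((|x| : ℝ) : ℂ) * ∫ t, Phi l y ξ x (x * t) := by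
    rw [h, Complex.real_smul, abs_inv]
    have : ((|x| : ℝ) : ℂ) ≠ 0 := by exact_mod_cast hxp.ne'
    push_cast
    field_simp
  rw [h', ← integral_indicator measurableSet_Ioo, ← integral_const_mul, ← integral_const_mul]
  congr 1; ext t
  by_cases ht : |t| < 1
  · have ht' : t ∈ Set.Ioo (-1:ℝ) 1 := abs_lt.1 ht
    have hlt : |x * t| < |x| := by
      rw [abs_mul]; exact mul_lt_of_lt_one_right hxp ht
    rw [Set.indicator_of_mem ht']
    have h1 : 0 < 1 - t ^ 2 := by nlinarith [ht'.1, ht'.2]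
    have hg : gden l y (x * t) x = (|x| ^ (2 * l) / |x|) * (1 - t ^ 2) ^ (l - 1) * (y ^ 2 + x ^ 2) ^ (-(l + 1)) := by
      simp only [gden, hden, Set.indicator, Set.mem_Ioi, hlt, if_true]
      rw [sq_abs, show x ^ 2 - (x * t) ^ 2 = |x| ^ 2 * (1 - t ^ 2) by rw [sq_abs]; ring,
        Real.mul_rpow (by positivity) h1.le, ← Real.rpow_natCast, ← Real.rpow_mul hxp.le]
      congr 1
      rw [← mul_assoc]; congr 1
      rw [show 2 * l = ((2:ℕ):ℝ) * (l - 1) + 2 by push_cast; ring, Real.rpow_add hxp, Real.rpow_two]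
      field_simp
    rw [Phi, hg, mul_div_cancel_left₀ _ hx]
    have e : -(Complex.I * (ξ:ℂ) * ((x * t : ℝ) : ℂ)) = -(Complex.I * (x : ℂ) * (ξ : ℂ)) * (t : ℂ) := by
      push_cast; ring
    rw [e]
    have : ((|x| : ℝ) : ℂ) ≠ 0 := by exact_mod_cast hxp.ne'
    push_cast
    field_simp
  · have ht' : t ∉ Set.Ioo (-1:ℝ) 1 := fun h => ht (abs_lt.2 h)
    have hlt : ¬ |x * t| < |x| := by
      rw [abs_mul]; push Not at ht ⊢; exact le_mul_of_one_le_right hxp.le ht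
    have hg : gden l y (x * t) x = 0 := Set.indicator_of_notMem hlt _
    rw [Set.indicator_of_notMem ht', Phi, hg]
    simp

theorem dunkl_transform_poisson_kernel (l : ℝ) (hl : 0 < l) (y ξ : ℝ) (hy : 0 < y) :
    ((cLam l : ℝ) : ℂ) *
        ∫ x : ℝ,
          (((mLam l * y * (y ^ 2 + x ^ 2) ^ (-(l + 1)) * |x| ^ (2 * l) : ℝ)) : ℂ) *
            Ek l (-(Complex.I * (x : ℂ) * (ξ : ℂ)))
      = ((Real.exp (-(y * |ξ|)) : ℝ) : ℂ) := by
  have h0 : ∀ᵐ x : ℝ, x ≠ 0 := by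
    simp [ae_iff]
  have h1 : ∫ x : ℝ, (((mLam l * y * (y ^ 2 + x ^ 2) ^ (-(l + 1)) * |x| ^ (2 * l) : ℝ)) : ℂ) *
            Ek l (-(Complex.I * (x : ℂ) * (ξ : ℂ)))
      = ∫ x : ℝ, (mLam l * y * cPrime l : ℂ) * ∫ u, Phi l y ξ x u := by
    refine integral_congr_ae ?_
    filter_upwards [h0] with x hx
    rw [Phi_u l y ξ x hx, Ek]
    push_cast; ring
  rw [h1, integral_const_mul, integral_integral_swap (Phi_int l y ξ hl hy)]
  simp only [Phi_x l y ξ _ hl hy]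
  rw [integral_const_mul, cauchy_fourier y ξ hy]
  have hc : cLam l * (mLam l * y * cPrime l * (l⁻¹ * (Real.pi / y))) = 1 := by
    unfold cLam mLam cPrime
    rw [Real.Gamma_add_one hl.ne', Real.Gamma_one_half_eq]
    have g1 := Real.Gamma_pos_of_pos hl
    have g2 := Real.Gamma_pos_of_pos (show 0 < l + 1/2 by linarith)
    have g3 : (0:ℝ) < 2 ^ (l + 1/2) := by positivity
    have g4 : Real.sqrt Real.pi ≠ 0 := (Real.sqrt_pos.2 Real.pi_pos).ne'
    have g5 := Real.sq_sqrt Real.pi_pos.le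
    generalize (2:ℝ) ^ (l + 1/2) = A at *
    generalize Real.Gamma (l + 1/2) = B at *
    generalize Real.Gamma l = C at *
    generalize Real.sqrt Real.pi = s at *
    rw [← g5]
    field_simp
  have hc' : (cLam l : ℂ) * (mLam l * y * cPrime l * ((l:ℂ)⁻¹ * (Real.pi / y))) = 1 := by
    exact_mod_cast hc
  push_cast
  linear_combination Complex.exp (-(y * (|ξ| : ℝ))) * hc'
end

section
/- Let λ>0. For every y>0 and every ξ ∈ ℝ with ξ ≠ 0, c_λ ∫_ℝ m_λ x (y²+x²)^{-(λ+1)} E_λ(-ixξ) |x|^{2λ} dx = −i sgn(ξ) e^{-y|ξ|}, where m_λ = 2^{λ+1/2}Γ(λ+1)/√π. Equivalently, the Dunkl transform of the conjugate λ-Poisson kernel Q_y(x) = m_λ x (y²+x²)^{-(λ+1)} is (F_λ Q_y)(ξ) = −i sgn(ξ) e^{-y|ξ|}. -/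
open MeasureTheory

theorem aux_intOn_cauchy (r : ℝ) (hr : 0 < r) :
    IntegrableOn (fun u : ℝ => u / (r ^ 2 + u ^ 2) ^ 2) (Set.Ioi 0) := by
  have hpos : ∀ u : ℝ, 0 < r ^ 2 + u ^ 2 := fun u => by positivity
  refine integrableOn_Ioi_deriv_of_nonneg' (g := fun u => -(1/2) * (r ^ 2 + u ^ 2)⁻¹) (l := -(1/2) * 0) ?_ ?_ ?_
  · intro x _
    have h1 : HasDerivAt (fun u : ℝ => r ^ 2 + u ^ 2) (2 * x) x := by
      simpa using (hasDerivAt_pow 2 x).const_add (r ^ 2)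
    have h2 := (h1.inv (hpos x).ne').const_mul (-(1/2 : ℝ))
    convert! h2 using 1
    ring
  · intro x hx
    have : (0:ℝ) < x := hx
    positivity
  · refine Filter.Tendsto.const_mul _ ?_
    refine Filter.Tendsto.inv_tendsto_atTop ?_
    refine Filter.tendsto_atTop_add_const_left _ _ (Filter.tendsto_pow_atTop (by norm_num))

theorem aux_integral_split {f : ℝ → ℂ} (h1 : IntegrableOn f (Set.Ioi 0))
    (h2 : IntegrableOn (fun x => f (-x)) (Set.Ioi 0)) :
    Integrable f ∧ ∫ x, f x = ∫ x in Set.Ioi (0:ℝ), (f x + f (-x)) := by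
  have h3 : IntegrableOn f (Set.Iio 0) := by
    have := IntegrableOn.comp_neg_Iio (f := fun x => f (-x)) (c := 0) (by simpa using h2)
    simpa only [neg_neg] using this
  have h3' : IntegrableOn f (Set.Iic 0) := (integrableOn_Iic_iff_integrableOn_Iio (by simp)).2 h3
  constructor
  · rw [← integrableOn_univ, ← Set.Iic_union_Ioi (a := (0:ℝ))]
    exact h3'.union h1
  · rw [← intervalIntegral.integral_Iic_add_Ioi h3' h1, integral_add h1 h2, integral_comp_neg_Ioi]
    simp [add_comm]

theorem aux_lap (a : ℂ) (ha : 0 < a.re) :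
    IntegrableOn (fun x : ℝ => (x : ℂ) * Complex.exp (-(a * x))) (Set.Ioi 0) ∧
    ∫ x in Set.Ioi (0:ℝ), (x : ℂ) * Complex.exp (-(a * x)) = 1 / a ^ 2 := by
  have hi : IntegrableOn (fun x : ℝ => (x : ℂ) * Complex.exp (-(a * x))) (Set.Ioi 0) := by
    have h1 := integrableOn_rpow_mul_exp_neg_mul_rpow (s := 1) (p := 1) (b := a.re) (by norm_num) (by norm_num) ha
    refine Integrable.mono' h1 (by fun_prop) ?_
    filter_upwards [ae_restrict_mem measurableSet_Ioi] with x hx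
    have : (0:ℝ) < x := hx
    simp [Complex.norm_exp, abs_of_pos this]
  have ha0 : a ≠ 0 := by
    intro h; rw [h] at ha; simp at ha
  refine ⟨hi, ?_⟩
  have hd : ∀ x ∈ Set.Ici (0:ℝ), HasDerivAt (fun x : ℝ => -((x : ℂ) / a + 1 / a ^ 2) * Complex.exp (-(a * x)))
      ((x : ℂ) * Complex.exp (-(a * x))) x := by
    intro x _
    have e0 : HasDerivAt (fun x : ℝ => (x : ℂ)) 1 x := Complex.ofRealCLM.hasDerivAt
    have e1 : HasDerivAt (fun x : ℝ => Complex.exp (-(a * x))) (Complex.exp (-(a * x)) * (-(a * 1))) x :=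
      ((e0.const_mul a).neg).cexp
    have e2 := ((e0.div_const a).add_const (1 / a ^ 2)).neg
    have e3 := e2.mul e1
    convert! e3 using 1
    simp only [Pi.neg_apply]
    field_simp
    ring
  have ht : Filter.Tendsto (fun x : ℝ => -((x : ℂ) / a + 1 / a ^ 2) * Complex.exp (-(a * x))) Filter.atTop (nhds 0) := by
    have t1 := tendsto_rpow_mul_exp_neg_mul_atTop_nhds_zero 1 a.re ha
    have t2 := tendsto_rpow_mul_exp_neg_mul_atTop_nhds_zero 0 a.re ha
    have t3 := (t1.const_mul ‖a‖⁻¹).add (t2.const_mul (‖a‖⁻¹ ^ 2))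
    simp only [mul_zero, add_zero] at t3
    refine squeeze_zero_norm' ?_ t3
    filter_upwards [Filter.eventually_gt_atTop 0] with x hx
    rw [norm_mul, norm_neg, Complex.norm_exp]
    have : ‖(x : ℂ) / a + 1 / a ^ 2‖ ≤ ‖a‖⁻¹ * x + ‖a‖⁻¹ ^ 2 := by
      refine (norm_add_le _ _).trans (le_of_eq ?_)
      simp [abs_of_pos hx]; ring
    refine (mul_le_mul_of_nonneg_right this (Real.exp_pos _).le).trans (le_of_eq ?_)
    simp; ring
  rw [integral_Ioi_of_hasDerivAt_of_tendsto' hd hi ht]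
  simp

theorem aux_sin (r ξ : ℝ) (hr : 0 < r) (hξ : 0 < ξ) :
    ∫ u in Set.Ioi (0:ℝ), Real.sin (ξ * u) * (u / (r ^ 2 + u ^ 2) ^ 2)
      = Real.pi * ξ / (4 * r) * Real.exp (-(r * ξ)) := by
  have hpos : ∀ u : ℝ, 0 < r ^ 2 + u ^ 2 := fun u => by positivity
  set φ : ℝ → ℂ := fun x => (x : ℂ) * Complex.exp (-((r * |x| : ℝ) : ℂ)) with hφ
  set h : ℝ → ℂ := fun k => -4 * Complex.I * r * ((k / (r ^ 2 + k ^ 2) ^ 2 : ℝ) : ℂ) with hh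
  have hφi : Integrable φ := by
    have hb := (aux_lap r (by simpa using hr)).1
    refine (aux_integral_split (f := φ) ?_ ?_).1
    · refine hb.congr_fun (fun x hx => ?_) measurableSet_Ioi
      have : (0:ℝ) < x := hx
      simp [φ, abs_of_pos this]
    · refine hb.neg.congr_fun (fun x hx => ?_) measurableSet_Ioi
      have : (0:ℝ) < x := hx
      simp [φ, abs_of_pos this]
  have hF : FourierTransform.fourier φ = fun w => h (2 * Real.pi * w) := by
    funext w
    rw [Real.fourier_real_eq_integral_exp_smul]
    set k := 2 * Real.pi * w with hk
    have h1 := aux_lap (r + k * Complex.I) (by simpa using hr)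
    have h2 := aux_lap (r - k * Complex.I) (by simpa using hr)
    have e1 : Set.EqOn (fun x : ℝ => (x : ℂ) * Complex.exp (-((r + k * Complex.I) * x)))
      (fun v : ℝ => Complex.exp (↑(-2 * Real.pi * v * w) * Complex.I) • φ v) (Set.Ioi 0) := by
      intro x hx
      have : (0:ℝ) < x := hx
      simp only [φ, abs_of_pos this, smul_eq_mul]
      rw [mul_left_comm, ← Complex.exp_add]
      congr 2
      simp [hk]; ring
    have e2 : Set.EqOn (fun x : ℝ => -((x : ℂ) * Complex.exp (-((r - k * Complex.I) * x))))
      (fun v : ℝ => Complex.exp (↑(-2 * Real.pi * (-v) * w) * Complex.I) • φ (-v)) (Set.Ioi 0) := by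
      intro x hx
      have : (0:ℝ) < x := hx
      simp only [φ, abs_neg, abs_of_pos this, smul_eq_mul]
      rw [mul_left_comm, ← Complex.exp_add, Complex.ofReal_neg, neg_mul]
      congr 3
      simp [hk]; ring
    have i1 := h1.1.congr_fun e1 measurableSet_Ioi
    have i2 := IntegrableOn.congr_fun h2.1.neg e2 measurableSet_Ioi
    rw [(aux_integral_split i1 i2).2, integral_add i1 i2, ← setIntegral_congr_fun measurableSet_Ioi e1,
      ← setIntegral_congr_fun measurableSet_Ioi e2, integral_neg, h1.2, h2.2]
    have n1 : (r + k * Complex.I : ℂ) ≠ 0 := by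
      intro h; have := congrArg Complex.re h; simp at this; exact hr.ne' this
    have n2 : (r - k * Complex.I : ℂ) ≠ 0 := by
      intro h; have := congrArg Complex.re h; simp at this; exact hr.ne' this
    have n3 : ((r:ℂ) ^ 2 + (k:ℂ) ^ 2) = (r + k * Complex.I) * (r - k * Complex.I) := by
      ring_nf; simp
    simp only [h]
    push_cast
    rw [n3]
    field_simp
    ring
  have hhi : Integrable h := by
    have hb := ((aux_intOn_cauchy r hr).ofReal (𝕜 := ℂ)).const_mul (-4 * Complex.I * r)
    refine (aux_integral_split (f := h) hb ?_).1
    refine IntegrableOn.congr_fun hb.neg (fun x hx => ?_) measurableSet_Ioi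
    simp [h]; ring
  have hc : Continuous φ := by fun_prop
  have hFi : Integrable (FourierTransform.fourier φ) := by
    rw [hF]
    exact (integrable_comp_mul_left_iff h (R := 2 * Real.pi) (by positivity)).2 hhi
  have key := congrFun (hc.fourierInv_fourier_eq hφi hFi) ξ
  rw [hF, Real.fourierInv_eq'] at key
  have e3 : (fun v : ℝ => Complex.exp (↑(2 * Real.pi * inner ℝ v ξ) * Complex.I) • h (2 * Real.pi * v))
     = fun v => (fun k : ℝ => Complex.exp (↑(k * ξ) * Complex.I) * h k) (2 * Real.pi * v) := by
    funext v
    simp [mul_assoc, mul_comm, mul_left_comm]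
  rw [e3, Measure.integral_comp_mul_left (fun k : ℝ => Complex.exp (↑(k * ξ) * Complex.I) * h k)] at key
  set G : ℝ → ℂ := fun k : ℝ => Complex.exp (↑(k * ξ) * Complex.I) * h k with hG
  have hGi : Integrable G := by
    refine hhi.norm.mono' (by fun_prop) (Filter.Eventually.of_forall fun k => ?_)
    simp [G, Complex.norm_exp]
  rw [(aux_integral_split hGi.integrableOn hGi.comp_neg.integrableOn).2] at key
  have e4 : ∀ k : ℝ, G k + G (-k) = ((8 * r * (Real.sin (ξ * k) * (k / (r ^ 2 + k ^ 2) ^ 2)) : ℝ) : ℂ) := by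
    intro k
    simp only [G, h]
    rw [show (((-k * ξ : ℝ) : ℂ) * Complex.I) = -((ξ * k : ℝ) : ℂ) * Complex.I by push_cast; ring,
      show (((k * ξ : ℝ) : ℂ) * Complex.I) = ((ξ * k : ℝ) : ℂ) * Complex.I by push_cast; ring]
    rw [show (-k / (r ^ 2 + (-k) ^ 2) ^ 2) = -(k / (r ^ 2 + k ^ 2) ^ 2) by ring]
    push_cast
    rw [Complex.sin]
    ring_nf
  simp_rw [e4] at key
  rw [integral_complex_ofReal, integral_const_mul] at key
  have hp : 0 < 2 * Real.pi := by positivity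
  rw [abs_of_pos (inv_pos.2 hp)] at key
  simp only [φ, abs_of_pos hξ] at key
  have key2 : (2 * Real.pi)⁻¹ * (8 * r * ∫ u in Set.Ioi (0:ℝ), Real.sin (ξ * u) * (u / (r ^ 2 + u ^ 2) ^ 2))
     = ξ * Real.exp (-(r * ξ)) := by
    have : (((2 * Real.pi)⁻¹ * (8 * r * ∫ u in Set.Ioi (0:ℝ), Real.sin (ξ * u) * (u / (r ^ 2 + u ^ 2) ^ 2)) : ℝ) : ℂ)
     = ((ξ * Real.exp (-(r * ξ)) : ℝ) : ℂ) := by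
      rw [Complex.ofReal_mul, ← Complex.real_smul]
      refine Eq.trans ?_ (key.trans ?_)
      · rfl
      · push_cast; rfl
    exact_mod_cast this
  field_simp at key2 ⊢
  linarith

theorem aux_inner (l r u : ℝ) (hl : 0 < l) (hr : 0 < r) (hu : 0 < u) :
    IntegrableOn (fun x : ℝ => x * (x ^ 2 - u ^ 2) ^ (l - 1) * (r ^ 2 + x ^ 2) ^ (-(l + 2))) (Set.Ioi u) ∧
    ∫ x in Set.Ioi u, x * (x ^ 2 - u ^ 2) ^ (l - 1) * (r ^ 2 + x ^ 2) ^ (-(l + 2))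
      = 1 / (2 * l * (l + 1)) * (1 / (r ^ 2 + u ^ 2) ^ 2) := by
  have hpos : ∀ x : ℝ, 0 < r ^ 2 + x ^ 2 := fun x => by positivity
  set A := r ^ 2 + u ^ 2 with hA
  have hA0 : 0 < A := hpos u
  let q : ℝ → ℝ := fun x => (x ^ 2 - u ^ 2) / (r ^ 2 + x ^ 2)
  let g : ℝ → ℝ := fun x => (q x ^ l / l - q x ^ (l + 1) / (l + 1)) / (2 * A ^ 2)
  have hqc : Continuous q := by
    refine Continuous.div (by fun_prop) (by fun_prop) (fun x => (hpos x).ne')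
  have hgc : Continuous g := by
    refine Continuous.div_const (Continuous.sub (Continuous.div_const ?_ _) (Continuous.div_const ?_ _)) _
    · exact hqc.rpow_const (fun x => Or.inr hl.le)
    · exact hqc.rpow_const (fun x => Or.inr (by linarith))
  have hd : ∀ x ∈ Set.Ioi u, HasDerivAt g (x * (x ^ 2 - u ^ 2) ^ (l - 1) * (r ^ 2 + x ^ 2) ^ (-(l + 2))) x := by
    intro x hx
    have hx' : u < x := hx
    have hx0 : 0 < x := hu.trans hx'
    have hB := hpos x
    have hD : 0 < x ^ 2 - u ^ 2 := by nlinarith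
    have hq0 : 0 < q x := div_pos hD hB
    have hq : HasDerivAt q ((2 * x * (r ^ 2 + x ^ 2) - (x ^ 2 - u ^ 2) * (2 * x)) / (r ^ 2 + x ^ 2) ^ 2) x := by
      have h1 : HasDerivAt (fun x : ℝ => x ^ 2 - u ^ 2) (2 * x) x := by
        simpa using (hasDerivAt_pow 2 x).sub_const (u ^ 2)
      have h2 : HasDerivAt (fun x : ℝ => r ^ 2 + x ^ 2) (2 * x) x := by
        simpa using (hasDerivAt_pow 2 x).const_add (r ^ 2)
      exact h1.div h2 hB.ne'
    have h3 := (((hq.rpow_const (p := l) (Or.inl hq0.ne')).div_const l).sub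
      ((hq.rpow_const (p := l + 1) (Or.inl hq0.ne')).div_const (l + 1))).div_const (2 * A ^ 2)
    convert! h3 using 1
    have e1 : q x ^ (l + 1 - 1) = q x ^ (l - 1) * q x := by
      rw [show l + 1 - 1 = (l - 1) + 1 by ring, Real.rpow_add hq0, Real.rpow_one]
    have e2 : q x ^ (l - 1) = (x ^ 2 - u ^ 2) ^ (l - 1) / (r ^ 2 + x ^ 2) ^ (l - 1) :=
      Real.div_rpow hD.le hB.le _
    have e3 : (r ^ 2 + x ^ 2) ^ (-(l + 2)) = 1 / ((r ^ 2 + x ^ 2) ^ (l - 1) * (r ^ 2 + x ^ 2) ^ 3) := by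
      rw [Real.rpow_neg hB.le, show l + 2 = (l - 1) + (3 : ℕ) by push_cast; ring, Real.rpow_add hB,
        Real.rpow_natCast, one_div]
    rw [e1, e2, e3]
    have hp := Real.rpow_pos_of_pos hB (l - 1)
    simp only [q]
    have e4 : x ^ 2 - u ^ 2 = (r ^ 2 + x ^ 2) - A := by rw [hA]; ring
    generalize (x ^ 2 - u ^ 2) ^ (l - 1) = W
    rw [e4]
    generalize (r ^ 2 + x ^ 2) ^ (l - 1) = V at *
    generalize (r ^ 2 + x ^ 2) = B at *
    clear_value A
    have hl1 : l + 1 ≠ 0 := by positivity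
    field_simp
    ring
  have hn : ∀ x ∈ Set.Ioi u, 0 ≤ x * (x ^ 2 - u ^ 2) ^ (l - 1) * (r ^ 2 + x ^ 2) ^ (-(l + 2)) := by
    intro x hx
    have hx' : u < x := hx
    have hx0 : 0 < x := hu.trans hx'
    have hB := hpos x
    have hD : 0 < x ^ 2 - u ^ 2 := by nlinarith
    positivity
  have hqt : Filter.Tendsto q Filter.atTop (nhds 1) := by
    have : q = fun x => 1 - A * (r ^ 2 + x ^ 2)⁻¹ := by
      funext x
      have hB := hpos x
      simp only [q, hA]
      field_simp
      ring
    rw [this]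
    have t : Filter.Tendsto (fun x : ℝ => (r ^ 2 + x ^ 2)⁻¹) Filter.atTop (nhds 0) :=
      Filter.Tendsto.inv_tendsto_atTop
        (Filter.tendsto_atTop_add_const_left _ _ (Filter.tendsto_pow_atTop (by norm_num)))
    simpa using (t.const_mul A).const_sub 1
  have ht : Filter.Tendsto g Filter.atTop (nhds ((1 / l - 1 / (l + 1)) / (2 * A ^ 2))) := by
    have t1 := hqt.rpow_const (p := l) (Or.inl one_ne_zero)
    have t2 := hqt.rpow_const (p := l + 1) (Or.inl one_ne_zero)
    simpa using ((t1.div_const l).sub (t2.div_const (l + 1))).div_const (2 * A ^ 2)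
  refine ⟨integrableOn_Ioi_deriv_of_nonneg hgc.continuousWithinAt hd hn ht, ?_⟩
  rw [integral_Ioi_of_hasDerivAt_of_nonneg hgc.continuousWithinAt hd hn ht]
  have : g u = 0 := by
    simp [g, q, Real.zero_rpow hl.ne', Real.zero_rpow (show l + 1 ≠ 0 by positivity)]
  rw [this]
  have hl1 : l + 1 ≠ 0 := by positivity
  field_simp
  ring

theorem aux_outer (l y x : ℝ) (hl : 0 < l) (hy : 0 < y) :
    IntegrableOn (fun r : ℝ => 2 * (l + 1) * r * (r ^ 2 + x ^ 2) ^ (-(l + 2))) (Set.Ioi y) ∧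
    ∫ r in Set.Ioi y, 2 * (l + 1) * r * (r ^ 2 + x ^ 2) ^ (-(l + 2)) = (y ^ 2 + x ^ 2) ^ (-(l + 1)) := by
  have hd : ∀ r ∈ Set.Ici y, HasDerivAt (fun r : ℝ => -(r ^ 2 + x ^ 2) ^ (-(l + 1)))
     (2 * (l + 1) * r * (r ^ 2 + x ^ 2) ^ (-(l + 2))) r := by
    intro r hr
    have hr0 : 0 < r := lt_of_lt_of_le hy hr
    have hB : 0 < r ^ 2 + x ^ 2 := by positivity
    have h2 : HasDerivAt (fun r : ℝ => r ^ 2 + x ^ 2) (2 * r) r := by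
      simpa using (hasDerivAt_pow 2 r).add_const (x ^ 2)
    have h3 := (h2.rpow_const (p := -(l + 1)) (Or.inl hB.ne')).neg
    convert! h3 using 1
    rw [show -(l + 1) - 1 = -(l + 2) by ring]
    ring
  have hn : ∀ r ∈ Set.Ioi y, 0 ≤ 2 * (l + 1) * r * (r ^ 2 + x ^ 2) ^ (-(l + 2)) := by
    intro r hr
    have hr0 : 0 < r := lt_trans hy hr
    positivity
  have ht : Filter.Tendsto (fun r : ℝ => -(r ^ 2 + x ^ 2) ^ (-(l + 1))) Filter.atTop (nhds (-0)) := by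
    refine Filter.Tendsto.neg ?_
    refine (tendsto_rpow_neg_atTop (y := l + 1) (by positivity)).comp ?_
    exact Filter.tendsto_atTop_add_const_right _ _ (Filter.tendsto_pow_atTop (by norm_num))
  refine ⟨integrableOn_Ioi_deriv_of_nonneg' hd hn ht, ?_⟩
  rw [integral_Ioi_of_hasDerivAt_of_nonneg' hd hn ht]
  simp

noncomputable def auxS (l z : ℝ) : ℝ :=
  ∫ t in Set.Ioo (0:ℝ) 1, Real.sin (z * t) * (t * (1 - t ^ 2) ^ (l - 1))

theorem aux_subst (l x ξ : ℝ) (hx : 0 < x) :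
    x ^ (2 * l) * auxS l (ξ * x) =
      ∫ u in Set.Ioi (0:ℝ), (if u < x then Real.sin (ξ * u) * (u * (x ^ 2 - u ^ 2) ^ (l - 1)) else 0) := by
  have h := integral_comp_mul_left_Ioi
    (fun u : ℝ => if u < x then Real.sin (ξ * u) * (u * (x ^ 2 - u ^ 2) ^ (l - 1)) else 0) 0 hx
  rw [mul_zero] at h
  have e : ∫ t in Set.Ioi (0:ℝ), (if x * t < x then Real.sin (ξ * (x * t)) * ((x * t) * (x ^ 2 - (x * t) ^ 2) ^ (l - 1)) else 0)
      = x ^ (2 * l) * x⁻¹ * auxS l (ξ * x) := by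
    rw [auxS, ← integral_const_mul, ← Set.Ioi_inter_Iio, Set.inter_comm,
      ← Measure.restrict_restrict measurableSet_Iio, ← integral_indicator measurableSet_Iio]
    refine setIntegral_congr_fun measurableSet_Ioi (fun t ht => ?_)
    have ht0 : (0:ℝ) < t := ht
    by_cases h1 : t < 1
    · have : x * t < x := by nlinarith
      simp only [this, if_true, Set.indicator, Set.mem_Iio, h1]
      have : (x ^ 2 - (x * t) ^ 2) ^ (l - 1) = x ^ (2 * l) * (x⁻¹) ^ 2 * (1 - t ^ 2) ^ (l - 1) := by
        rw [show x ^ 2 - (x * t) ^ 2 = x ^ 2 * (1 - t ^ 2) by ring,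
          Real.mul_rpow (by positivity) (by nlinarith), ← Real.rpow_natCast x 2, ← Real.rpow_mul hx.le,
          show ((2:ℕ):ℝ) * (l - 1) = 2 * l - (2:ℕ) by push_cast; ring, Real.rpow_sub hx, Real.rpow_natCast]
        ring
      rw [this, ← mul_assoc ξ]
      field_simp
    · have : ¬ x * t < x := by nlinarith
      simp only [this, if_false, Set.indicator, Set.mem_Iio, h1]
  simp only [smul_eq_mul] at h
  rw [e] at h
  refine mul_left_cancel₀ (inv_ne_zero hx.ne') ?_
  rw [← h]
  ring

theorem aux_stepB (l r ξ : ℝ) (hl : 0 < l) (hr : 0 < r) :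
    ∫ x in Set.Ioi (0:ℝ), x * (r ^ 2 + x ^ 2) ^ (-(l + 2)) * (x ^ (2 * l) * auxS l (ξ * x))
      = 1 / (2 * l * (l + 1)) * ∫ u in Set.Ioi (0:ℝ), Real.sin (ξ * u) * (u / (r ^ 2 + u ^ 2) ^ 2) := by
  let F : ℝ → ℝ → ℝ := fun x u => if u < x then
    Real.sin (ξ * u) * u * (x * (x ^ 2 - u ^ 2) ^ (l - 1) * (r ^ 2 + x ^ 2) ^ (-(l + 2))) else 0
  have hin : ∀ u ∈ Set.Ioi (0:ℝ), IntegrableOn (fun x => F x u) (Set.Ioi 0) ∧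
      (∫ x in Set.Ioi (0:ℝ), F x u) = 1 / (2 * l * (l + 1)) * (Real.sin (ξ * u) * (u / (r ^ 2 + u ^ 2) ^ 2)) ∧
      (∫ x in Set.Ioi (0:ℝ), ‖F x u‖) = 1 / (2 * l * (l + 1)) * (|Real.sin (ξ * u)| * (u / (r ^ 2 + u ^ 2) ^ 2)) := by
    intro u hu
    have hu0 : (0:ℝ) < u := hu
    obtain ⟨h1, h2⟩ := aux_inner l r u hl hr hu0
    have hsub : Set.Ioi u ⊆ Set.Ioi (0:ℝ) := Set.Ioi_subset_Ioi hu0.le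
    have eF : (fun x => F x u) = (Set.Ioi u).indicator (fun x => Real.sin (ξ * u) * u * (x * (x ^ 2 - u ^ 2) ^ (l - 1) * (r ^ 2 + x ^ 2) ^ (-(l + 2)))) := by
      funext x
      simp [F, Set.indicator]
    have eN : ∀ x, ‖F x u‖ = (Set.Ioi u).indicator (fun x => |Real.sin (ξ * u)| * u * (x * (x ^ 2 - u ^ 2) ^ (l - 1) * (r ^ 2 + x ^ 2) ^ (-(l + 2)))) x := by
      intro x
      by_cases hx : u < x
      · have hD : 0 < x ^ 2 - u ^ 2 := by nlinarith
        have hx0 : 0 < x := hu0.trans hx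
        have : 0 ≤ x * (x ^ 2 - u ^ 2) ^ (l - 1) * (r ^ 2 + x ^ 2) ^ (-(l + 2)) := by positivity
        simp only [F, hx, if_true, Set.indicator, Set.mem_Ioi]
        rw [norm_mul, norm_mul, Real.norm_of_nonneg this, Real.norm_of_nonneg hu0.le, Real.norm_eq_abs]
      · simp [F, hx]
    have hset : Set.Ioi u ∩ Set.Ioi (0:ℝ) = Set.Ioi u := Set.inter_eq_left.2 hsub
    refine ⟨?_, ?_, ?_⟩
    · rw [eF]
      have h3 : IntegrableOn (fun x => Real.sin (ξ * u) * u * (x * (x ^ 2 - u ^ 2) ^ (l - 1) * (r ^ 2 + x ^ 2) ^ (-(l + 2)))) (Set.Ioi u) :=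
        h1.const_mul _
      exact (h3.integrable_indicator measurableSet_Ioi).integrableOn
    · rw [eF, integral_indicator measurableSet_Ioi, Measure.restrict_restrict measurableSet_Ioi, hset,
        integral_const_mul, h2]
      ring
    · simp_rw [eN]
      rw [integral_indicator measurableSet_Ioi, Measure.restrict_restrict measurableSet_Ioi, hset,
        integral_const_mul, h2]
      ring
  have hFm : Measurable (Function.uncurry F) := by
    refine Measurable.ite (measurableSet_lt measurable_snd measurable_fst) ?_ measurable_const
    fun_prop
  have hFi : Integrable (Function.uncurry F) ((volume.restrict (Set.Ioi (0:ℝ))).prod (volume.restrict (Set.Ioi (0:ℝ)))) := by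
    rw [integrable_prod_iff' hFm.aestronglyMeasurable]
    constructor
    · filter_upwards [ae_restrict_mem measurableSet_Ioi] with u hu
      exact (hin u hu).1
    · have hb : IntegrableOn (fun u : ℝ => 1 / (2 * l * (l + 1)) * (|Real.sin (ξ * u)| * (u / (r ^ 2 + u ^ 2) ^ 2))) (Set.Ioi 0) := by
        refine Integrable.const_mul ?_ _
        refine (aux_intOn_cauchy r hr).norm.mono' (Measurable.aestronglyMeasurable (by fun_prop)) ?_
        refine Filter.Eventually.of_forall fun u => ?_
        rw [norm_mul, Real.norm_eq_abs, abs_abs]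
        exact mul_le_of_le_one_left (norm_nonneg _) (Real.abs_sin_le_one _)
      exact hb.congr_fun (fun u hu => ((hin u hu).2.2).symm) measurableSet_Ioi
  have hsw := integral_integral_swap hFi
  rw [setIntegral_congr_fun measurableSet_Ioi (fun u hu => (hin u hu).2.1), integral_const_mul] at hsw
  rw [← hsw]
  refine setIntegral_congr_fun measurableSet_Ioi (fun x hx => ?_)
  rw [aux_subst l x ξ hx, ← integral_const_mul]
  congr 1
  funext u
  simp only [F]
  split_ifs <;> ring

theorem aux_osc (l : ℝ) (hl : 0 < l) (H H' : ℝ → ℝ) (hd : ∀ s ∈ Set.Icc (0:ℝ) 1, HasDerivAt H (H' s) s)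
    (hH' : ContinuousOn H' (Set.Icc 0 1)) :
    ∃ C : ℝ, 0 ≤ C ∧ ∀ z : ℝ, 1 ≤ |z| →
      ‖∫ s in (0:ℝ)..1, Complex.exp (Complex.I * z * s) * ((H s * s ^ (l - 1) : ℝ) : ℂ)‖
        ≤ C * (|z| ^ (-(l / 3)) + |z| ^ (-(1 / 3 : ℝ))) := by
  have hH : ContinuousOn H (Set.Icc 0 1) := fun s hs => (hd s hs).continuousAt.continuousWithinAt
  obtain ⟨M1, hM1⟩ := isCompact_Icc.exists_bound_of_continuousOn hH
  obtain ⟨M2, hM2⟩ := isCompact_Icc.exists_bound_of_continuousOn hH'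
  obtain ⟨M, hM0, hMH, hMH'⟩ : ∃ M : ℝ, 0 ≤ M ∧ (∀ s ∈ Set.Icc (0:ℝ) 1, |H s| ≤ M) ∧
      (∀ s ∈ Set.Icc (0:ℝ) 1, |H' s| ≤ M) := by
    refine ⟨max 0 (max M1 M2), le_max_left _ _, fun s hs => ?_, fun s hs => ?_⟩
    · exact (hM1 s hs).trans ((le_max_left _ _).trans (le_max_right _ _))
    · exact (hM2 s hs).trans ((le_max_right _ _).trans (le_max_right _ _))
  refine ⟨M / l + M * (3 + |l - 1|), by positivity, fun z hz => ?_⟩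
  have hz0 : 0 < |z| := by linarith
  have hzne : z ≠ 0 := abs_pos.1 hz0
  set δ : ℝ := |z| ^ (-(1 / 3 : ℝ)) with hδ
  have hδ0 : 0 < δ := Real.rpow_pos_of_pos hz0 _
  have hδ1 : δ ≤ 1 := Real.rpow_le_one_of_one_le_of_nonpos hz (by norm_num)
  set p : ℝ → ℂ := fun s => ((H s * s ^ (l - 1) : ℝ) : ℂ) with hp
  set f : ℝ → ℂ := fun s => Complex.exp (Complex.I * z * s) * p s with hf
  have hexp : ∀ s : ℝ, ‖Complex.exp (Complex.I * z * s)‖ = 1 := by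
    intro s; simp [Complex.norm_exp]
  have hpi : IntervalIntegrable (fun s => H s * s ^ (l - 1)) volume 0 1 := by
    refine (intervalIntegral.intervalIntegrable_rpow' (by linarith)).continuousOn_mul ?_
    rwa [Set.uIcc_of_le zero_le_one]
  have hpi' : IntervalIntegrable p volume 0 1 := ⟨hpi.1.ofReal (𝕜 := ℂ), hpi.2.ofReal (𝕜 := ℂ)⟩
  have hfi : IntervalIntegrable f volume 0 1 := hpi'.continuousOn_mul (by fun_prop)
  have m1 : δ ∈ Set.uIcc (0:ℝ) 1 := by rw [Set.uIcc_of_le zero_le_one]; exact ⟨hδ0.le, hδ1⟩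
  have hf1 : IntervalIntegrable f volume 0 δ := hfi.mono_set (Set.uIcc_subset_uIcc Set.left_mem_uIcc m1)
  have hf2 : IntervalIntegrable f volume δ 1 := hfi.mono_set (Set.uIcc_subset_uIcc m1 Set.right_mem_uIcc)
  have hsplit : ∫ s in (0:ℝ)..1, f s = (∫ s in (0:ℝ)..δ, f s) + ∫ s in δ..1, f s :=
    (intervalIntegral.integral_add_adjacent_intervals hf1 hf2).symm
  have b1 : ‖∫ s in (0:ℝ)..δ, f s‖ ≤ M / l * |z| ^ (-(l / 3)) := by
    have h1 : ‖∫ s in (0:ℝ)..δ, f s‖ ≤ ∫ s in (0:ℝ)..δ, M * s ^ (l - 1) := by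
      refine intervalIntegral.norm_integral_le_of_norm_le hδ0.le (Filter.Eventually.of_forall fun s hs => ?_)
        ((intervalIntegral.intervalIntegrable_rpow' (by linarith)).const_mul M)
      have hs0 : 0 < s := hs.1
      simp only [f, p]
      rw [norm_mul, hexp, one_mul, Complex.norm_real, norm_mul, Real.norm_of_nonneg (Real.rpow_nonneg hs0.le _)]
      exact mul_le_mul_of_nonneg_right (hMH s ⟨hs0.le, hs.2.trans hδ1⟩) (Real.rpow_nonneg hs0.le _)
    rw [intervalIntegral.integral_const_mul, integral_rpow (Or.inl (by linarith))] at h1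
    refine h1.trans (le_of_eq ?_)
    rw [sub_add_cancel, Real.zero_rpow hl.ne', hδ, ← Real.rpow_mul hz0.le,
      show -(1 / 3 : ℝ) * l = -(l / 3) by ring]
    ring
  have hpow : ∀ s ∈ Set.Icc δ 1, s ^ (l - 1) ≤ δ⁻¹ ∧ s ^ (l - 2) ≤ δ⁻¹ ^ 2 ∧ 0 ≤ s ^ (l - 1) ∧ 0 ≤ s ^ (l - 2) := by
    intro s hs
    have hs0 : 0 < s := hδ0.trans_le hs.1
    have hi : s⁻¹ ≤ δ⁻¹ := inv_anti₀ hδ0 hs.1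
    refine ⟨?_, ?_, Real.rpow_nonneg hs0.le _, Real.rpow_nonneg hs0.le _⟩
    · refine (Real.rpow_le_rpow_of_exponent_ge hs0 hs.2 (show (-1:ℝ) ≤ l - 1 by linarith)).trans ?_
      rwa [Real.rpow_neg_one]
    · refine (Real.rpow_le_rpow_of_exponent_ge hs0 hs.2 (show (-2:ℝ) ≤ l - 2 by linarith)).trans ?_
      rw [Real.rpow_neg hs0.le, Real.rpow_two, ← inv_pow]
      gcongr
  have hδi : 1 ≤ δ⁻¹ := (one_le_inv₀ hδ0).2 hδ1
  have hpb : ∀ s ∈ Set.Icc δ 1, ‖p s‖ ≤ M * δ⁻¹ := by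
    intro s hs
    have hs' : s ∈ Set.Icc (0:ℝ) 1 := ⟨hδ0.le.trans hs.1, hs.2⟩
    simp only [p]
    rw [Complex.norm_real, norm_mul, Real.norm_of_nonneg (hpow s hs).2.2.1]
    exact mul_le_mul (hMH s hs') (hpow s hs).1 (hpow s hs).2.2.1 hM0
  let p' : ℝ → ℂ := fun s => ((H' s * s ^ (l - 1) + H s * ((l - 1) * s ^ (l - 2)) : ℝ) : ℂ)
  have hp'b : ∀ s ∈ Set.Icc δ 1, ‖p' s‖ ≤ M * (1 + |l - 1|) * δ⁻¹ ^ 2 := by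
    intro s hs
    have hs' : s ∈ Set.Icc (0:ℝ) 1 := ⟨hδ0.le.trans hs.1, hs.2⟩
    obtain ⟨q1, q2, q3, q4⟩ := hpow s hs
    simp only [p']
    rw [Complex.norm_real]
    refine (norm_add_le _ _).trans ?_
    rw [norm_mul, norm_mul, norm_mul, Real.norm_of_nonneg q3, Real.norm_of_nonneg q4]
    have a1 : ‖H' s‖ * s ^ (l - 1) ≤ M * δ⁻¹ ^ 2 :=
      mul_le_mul (hMH' s hs') (q1.trans (by nlinarith)) q3 hM0
    have a2 : ‖H s‖ * (‖l - 1‖ * s ^ (l - 2)) ≤ M * (|l - 1| * δ⁻¹ ^ 2) :=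
      mul_le_mul (hMH s hs') (mul_le_mul_of_nonneg_left q2 (norm_nonneg _)) (by positivity) hM0
    nlinarith
  let v : ℝ → ℂ := fun s => Complex.exp (Complex.I * z * s) / (Complex.I * z)
  have hvn : ∀ s, ‖v s‖ = |z|⁻¹ := by
    intro s
    simp only [v]
    rw [norm_div, hexp]
    simp
  have hIz : Complex.I * (z:ℂ) ≠ 0 := by simp [hzne]
  have hdv : ∀ s ∈ Set.uIcc δ 1, HasDerivAt v (Complex.exp (Complex.I * z * s)) s := by
    intro s _
    have e0 : HasDerivAt (fun x : ℝ => (x : ℂ)) 1 s := Complex.ofRealCLM.hasDerivAt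
    have e1 := ((e0.const_mul (Complex.I * z)).cexp).div_const (Complex.I * z)
    convert! e1 using 1
    rw [mul_one, mul_div_cancel_right₀ _ hIz]
  have hdp : ∀ s ∈ Set.uIcc δ 1, HasDerivAt p (p' s) s := by
    intro s hs
    rw [Set.uIcc_of_le hδ1] at hs
    have hs0 : 0 < s := hδ0.trans_le hs.1
    have h1 := (hd s ⟨hs0.le, hs.2⟩).mul (Real.hasDerivAt_rpow_const (x := s) (p := l - 1) (Or.inl hs0.ne'))
    have h2 := h1.ofReal_comp
    convert! h2 using 1
    simp only [p']
    rw [show l - 1 - 1 = l - 2 by ring]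
  have hp'i : IntervalIntegrable p' volume δ 1 := by
    refine ContinuousOn.intervalIntegrable ?_
    rw [Set.uIcc_of_le hδ1]
    have hsub : Set.Icc δ 1 ⊆ Set.Icc 0 1 := Set.Icc_subset_Icc_left hδ0.le
    have hr : ∀ a : ℝ, ContinuousOn (fun s : ℝ => s ^ a) (Set.Icc δ 1) := fun a =>
      continuousOn_id.rpow_const (fun s hs => Or.inl (hδ0.trans_le hs.1).ne')
    refine Complex.continuous_ofReal.comp_continuousOn ?_
    exact ((hH'.mono hsub).mul (hr _)).add ((hH.mono hsub).mul (continuousOn_const.mul (hr _)))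
  have hibp := intervalIntegral.integral_mul_deriv_eq_deriv_mul hdp hdv hp'i
    (Continuous.intervalIntegrable (by fun_prop) _ _)
  have b2 : ‖∫ s in δ..1, f s‖ ≤ M * (3 + |l - 1|) * δ := by
    have e : ∫ s in δ..1, f s = ∫ s in δ..1, p s * Complex.exp (Complex.I * z * s) := by
      simp only [f, mul_comm]
    rw [e, hibp]
    have c1 : ‖∫ s in δ..1, p' s * v s‖ ≤ M * (1 + |l - 1|) * δ⁻¹ ^ 2 * |z|⁻¹ * |1 - δ| := by
      refine intervalIntegral.norm_integral_le_of_norm_le_const (fun s hs => ?_)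
      rw [Set.uIoc_of_le hδ1] at hs
      rw [norm_mul, hvn]
      exact mul_le_mul_of_nonneg_right (hp'b s ⟨hs.1.le, hs.2⟩) (by positivity)
    have c2 : ‖p 1 * v 1‖ ≤ M * δ⁻¹ * |z|⁻¹ := by
      rw [norm_mul, hvn]
      exact mul_le_mul_of_nonneg_right (hpb 1 ⟨hδ1, le_rfl⟩) (by positivity)
    have c3 : ‖p δ * v δ‖ ≤ M * δ⁻¹ * |z|⁻¹ := by
      rw [norm_mul, hvn]
      exact mul_le_mul_of_nonneg_right (hpb δ ⟨le_rfl, hδ1⟩) (by positivity)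
    have c4 : δ⁻¹ ^ 2 * |z|⁻¹ = δ := by
      rw [hδ, ← Real.rpow_neg_one, ← Real.rpow_mul hz0.le, ← Real.rpow_natCast, ← Real.rpow_mul hz0.le,
        ← Real.rpow_neg_one |z|, ← Real.rpow_add hz0]
      norm_num
    have c5 : |1 - δ| ≤ 1 := by rw [abs_of_nonneg (by linarith)]; linarith
    have c6 : M * (1 + |l - 1|) * δ⁻¹ ^ 2 * |z|⁻¹ * |1 - δ| ≤ M * (1 + |l - 1|) * δ := by
      calc _ = M * (1 + |l - 1|) * (δ⁻¹ ^ 2 * |z|⁻¹) * |1 - δ| := by ring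
        _ = M * (1 + |l - 1|) * δ * |1 - δ| := by rw [c4]
        _ ≤ _ := mul_le_of_le_one_right (by positivity) c5
    have c7 : M * δ⁻¹ * |z|⁻¹ ≤ M * δ := by
      rw [mul_assoc]
      refine mul_le_mul_of_nonneg_left ?_ hM0
      rw [← c4]
      refine mul_le_mul_of_nonneg_right ?_ (by positivity)
      rw [c4]
      nlinarith
    refine (norm_sub_le _ _).trans ?_
    have := norm_sub_le (p 1 * v 1) (p δ * v δ)
    nlinarith
  change ‖∫ s in (0:ℝ)..1, f s‖ ≤ _
  rw [hsplit]
  refine (norm_add_le _ _).trans ((add_le_add b1 b2).trans ?_)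
  have : 0 ≤ |z| ^ (-(l / 3)) := by positivity
  have a1 : 0 ≤ M / l := by positivity
  have a2 : 0 ≤ M * (3 + |l - 1|) := by positivity
  nlinarith [mul_nonneg a1 hδ0.le, mul_nonneg a2 this]

theorem aux_g_eq (l t : ℝ) (ht : t ∈ Set.Ioo (-1:ℝ) 1) :
    (1 + t) * (1 - t ^ 2) ^ (l - 1) = (1 + t) ^ l * (1 - t) ^ (l - 1) := by
  have h1 : 0 < 1 + t := by linarith [ht.1]
  have h2 : 0 < 1 - t := by linarith [ht.2]
  rw [show 1 - t ^ 2 = (1 + t) * (1 - t) by ring, Real.mul_rpow h1.le h2.le, ← mul_assoc]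
  congr 1
  rw [Real.rpow_sub_one h1.ne']
  field_simp

theorem aux_g_int (l : ℝ) (hl : 0 < l) :
    IntervalIntegrable (fun t : ℝ => (1 + t) * (1 - t ^ 2) ^ (l - 1)) volume (-1) 1 := by
  have h1 : IntervalIntegrable (fun t : ℝ => (1 - t) ^ (l - 1)) volume (-1) 1 := by
    have := (intervalIntegral.intervalIntegrable_rpow' (a := 2) (b := 0) (r := l - 1) (by linarith)).comp_sub_left 1
    norm_num at this
    exact this
  have h2 : IntervalIntegrable (fun t : ℝ => (1 + t) ^ l * (1 - t) ^ (l - 1)) volume (-1) 1 :=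
    h1.continuousOn_mul (Continuous.continuousOn
      ((by fun_prop : Continuous fun t : ℝ => 1 + t).rpow_const (fun _ => Or.inr hl.le)))
  rw [intervalIntegrable_iff_integrableOn_Ioo_of_le (by norm_num)] at h2 ⊢
  exact h2.congr_fun (fun t ht => (aux_g_eq l t ht).symm) measurableSet_Ioo

theorem aux_Ek_integrable (l : ℝ) (hl : 0 < l) (z : ℝ) :
    IntegrableOn (fun t : ℝ => Complex.exp (Complex.I * z * (t : ℂ)) * (((1 + t) * (1 - t ^ 2) ^ (l - 1) : ℝ) : ℂ))
      (Set.Ioo (-1 : ℝ) 1) := by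
  have h := aux_g_int l hl
  rw [intervalIntegrable_iff_integrableOn_Ioo_of_le (by norm_num)] at h
  refine h.norm.mono' (Measurable.aestronglyMeasurable (by fun_prop)) (Filter.Eventually.of_forall fun t => ?_)
  rw [norm_mul, Complex.norm_real, Complex.norm_exp]
  simp

theorem aux_Ek_cont (l : ℝ) (hl : 0 < l) : Continuous fun z : ℝ => Ek l (Complex.I * z) := by
  have h := aux_g_int l hl
  rw [intervalIntegrable_iff_integrableOn_Ioo_of_le (by norm_num)] at h
  refine continuous_const.mul (continuous_of_dominated (bound := fun t => ‖(1 + t) * (1 - t ^ 2) ^ (l - 1)‖)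
    (fun z => (aux_Ek_integrable l hl z).1) ?_ h.norm ?_)
  · refine fun z => Filter.Eventually.of_forall fun t => ?_
    rw [norm_mul, Complex.norm_real, Complex.norm_exp]
    simp
  · refine Filter.Eventually.of_forall fun t => by fun_prop

theorem aux_Ek_decay (l : ℝ) (hl : 0 < l) : ∃ C : ℝ, 0 ≤ C ∧ ∀ z : ℝ, 1 ≤ |z| →
    ‖Ek l (Complex.I * z)‖ ≤ C * (|z| ^ (-(l / 3)) + |z| ^ (-(1 / 3 : ℝ))) := by
  have hder : ∀ a : ℝ, ∀ s ∈ Set.Icc (0:ℝ) 1, HasDerivAt (fun s : ℝ => (2 - s) ^ a) (-1 * a * (2 - s) ^ (a - 1)) s := by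
    intro a s hs
    have h1 : HasDerivAt (fun s : ℝ => 2 - s) (-1) s := by simpa using (hasDerivAt_id s).const_sub 2
    exact h1.rpow_const (Or.inl (by linarith [hs.2]))
  have hcon : ∀ a : ℝ, ContinuousOn (fun s : ℝ => (2 - s) ^ a) (Set.Icc 0 1) := by
    intro a s hs
    exact (hder a s hs).continuousAt.continuousWithinAt
  obtain ⟨C1, hC1, h1⟩ := aux_osc l hl (fun s => (2 - s) ^ l) (fun s => -1 * l * (2 - s) ^ (l - 1))
    (hder l) (continuousOn_const.mul (hcon _))
  obtain ⟨C2, hC2, h2⟩ := aux_osc l hl (fun s => s * (2 - s) ^ (l - 1))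
    (fun s => 1 * (2 - s) ^ (l - 1) + s * (-1 * (l - 1) * (2 - s) ^ (l - 1 - 1)))
    (fun s hs => (hasDerivAt_id s).mul (hder (l - 1) s hs))
    ((continuousOn_const.mul (hcon _)).add (continuousOn_id.mul (continuousOn_const.mul (hcon _))))
  refine ⟨‖(cPrime l : ℂ)‖ * (C1 + C2), by positivity, fun z hz => ?_⟩
  have hi := aux_Ek_integrable l hl z
  set f : ℝ → ℂ := fun t : ℝ => Complex.exp (Complex.I * z * (t : ℂ)) * (((1 + t) * (1 - t ^ 2) ^ (l - 1) : ℝ) : ℂ) with hf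
  rw [← intervalIntegrable_iff_integrableOn_Ioo_of_le (by norm_num)] at hi
  have m0 : (0:ℝ) ∈ Set.uIcc (-1:ℝ) 1 := by rw [Set.uIcc_of_le (by norm_num)]; norm_num
  have i1 := hi.mono_set (Set.uIcc_subset_uIcc Set.left_mem_uIcc m0)
  have i2 := hi.mono_set (Set.uIcc_subset_uIcc m0 Set.right_mem_uIcc)
  have e0 : Ek l (Complex.I * z) = (cPrime l : ℂ) * ((∫ t in (-1:ℝ)..0, f t) + ∫ t in (0:ℝ)..1, f t) := by
    rw [intervalIntegral.integral_add_adjacent_intervals i1 i2, intervalIntegral.integral_of_le (by norm_num),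
      integral_Ioc_eq_integral_Ioo]
    rfl
  have e1 : ∫ t in (0:ℝ)..1, f t = Complex.exp (Complex.I * z) *
      ∫ s in (0:ℝ)..1, Complex.exp (Complex.I * (-z : ℝ) * s) * (((2 - s) ^ l * s ^ (l - 1) : ℝ) : ℂ) := by
    have := intervalIntegral.integral_comp_sub_left (a := 0) (b := 1) f 1
    rw [sub_self, sub_zero] at this
    rw [← this, ← intervalIntegral.integral_const_mul, intervalIntegral.integral_of_le zero_le_one,
      intervalIntegral.integral_of_le zero_le_one, integral_Ioc_eq_integral_Ioo, integral_Ioc_eq_integral_Ioo]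
    refine setIntegral_congr_fun measurableSet_Ioo (fun s hs => ?_)
    simp only [f]
    rw [aux_g_eq l (1 - s) ⟨by linarith [hs.2], by linarith [hs.1]⟩, ← mul_assoc, ← Complex.exp_add]
    congr 2
    · push_cast; ring
    · ring_nf
  have e2 : ∫ t in (-1:ℝ)..0, f t = Complex.exp (-(Complex.I * z)) *
      ∫ s in (0:ℝ)..1, Complex.exp (Complex.I * z * s) * ((s * (2 - s) ^ (l - 1) * s ^ (l - 1) : ℝ) : ℂ) := by
    have := intervalIntegral.integral_comp_sub_right (a := 0) (b := 1) f 1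
    rw [sub_self, zero_sub] at this
    rw [← this, ← intervalIntegral.integral_const_mul, intervalIntegral.integral_of_le zero_le_one,
      intervalIntegral.integral_of_le zero_le_one, integral_Ioc_eq_integral_Ioo, integral_Ioc_eq_integral_Ioo]
    refine setIntegral_congr_fun measurableSet_Ioo (fun s hs => ?_)
    simp only [f]
    rw [← mul_assoc, ← Complex.exp_add]
    congr 2
    · push_cast; ring
    · rw [show 1 - (s - 1) ^ 2 = (2 - s) * s by ring, Real.mul_rpow (by linarith [hs.2]) hs.1.le]
      ring
  rw [e0, norm_mul, mul_assoc]
  refine mul_le_mul_of_nonneg_left ?_ (norm_nonneg _)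
  refine (norm_add_le _ _).trans ?_
  rw [e1, e2, norm_mul, norm_mul]
  have n1 : ‖Complex.exp (Complex.I * z)‖ = 1 := by simp [Complex.norm_exp]
  have n2 : ‖Complex.exp (-(Complex.I * z))‖ = 1 := by simp [Complex.norm_exp]
  rw [n1, n2, one_mul, one_mul]
  have k1 := h1 (-z) (by rwa [abs_neg])
  have k2 := h2 z hz
  rw [abs_neg] at k1
  linarith

theorem aux_S_integrable (l z : ℝ) (hl : 0 < l) :
    IntervalIntegrable (fun t : ℝ => Real.sin (z * t) * ((1 + t) * (1 - t ^ 2) ^ (l - 1))) volume (-1) 1 :=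
  (aux_g_int l hl).continuousOn_mul (by fun_prop)

theorem aux_S_cont (l : ℝ) (hl : 0 < l) : Continuous (auxS l) := by
  have h := aux_g_int l hl
  rw [intervalIntegrable_iff_integrableOn_Ioo_of_le (by norm_num)] at h
  have h' := h.mono_set (Set.Ioo_subset_Ioo_left (show (-1:ℝ) ≤ 0 by norm_num))
  refine continuous_of_dominated (bound := fun t => (1 + t) * (1 - t ^ 2) ^ (l - 1))
    (fun z => Measurable.aestronglyMeasurable (by fun_prop)) ?_ h' ?_
  · intro z
    filter_upwards [ae_restrict_mem measurableSet_Ioo] with t ht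
    have h1 : 0 ≤ 1 - t ^ 2 := by nlinarith [ht.1, ht.2]
    have h2 : 0 ≤ (1 - t ^ 2) ^ (l - 1) := Real.rpow_nonneg h1 _
    rw [norm_mul, norm_mul, Real.norm_of_nonneg ht.1.le, Real.norm_of_nonneg h2]
    have h3 : 0 ≤ t * (1 - t ^ 2) ^ (l - 1) := mul_nonneg ht.1.le h2
    have h4 := mul_le_of_le_one_left h3 (Real.abs_sin_le_one (z * t))
    rw [Real.norm_eq_abs]
    linarith
  · exact Filter.Eventually.of_forall fun t => by fun_prop

theorem aux_S_neg (l z : ℝ) : auxS l (-z) = -auxS l z := by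
  simp [auxS, integral_neg]

theorem aux_Ek_diff (l z : ℝ) (hl : 0 < l) :
    Ek l (Complex.I * (-z : ℝ)) - Ek l (Complex.I * z) = -4 * Complex.I * cPrime l * auxS l z := by
  have hi := aux_S_integrable l z hl
  have hS : ∫ t in Set.Ioo (-1:ℝ) 1, Real.sin (z * t) * ((1 + t) * (1 - t ^ 2) ^ (l - 1)) = 2 * auxS l z := by
    rw [← integral_Ioc_eq_integral_Ioo, ← intervalIntegral.integral_of_le (by norm_num)]
    have m0 : (0:ℝ) ∈ Set.uIcc (-1:ℝ) 1 := by rw [Set.uIcc_of_le (by norm_num)]; norm_num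
    have i1 := hi.mono_set (Set.uIcc_subset_uIcc Set.left_mem_uIcc m0)
    have i2 := hi.mono_set (Set.uIcc_subset_uIcc m0 Set.right_mem_uIcc)
    rw [← intervalIntegral.integral_add_adjacent_intervals i1 i2]
    have e := intervalIntegral.integral_comp_neg (a := 0) (b := 1)
      (fun t : ℝ => Real.sin (z * t) * ((1 + t) * (1 - t ^ 2) ^ (l - 1)))
    rw [neg_zero] at e
    have i1' := (IntervalIntegrable.iff_comp_neg (by simp)).1 i1
    rw [neg_zero, neg_neg] at i1'
    rw [← e, ← intervalIntegral.integral_add i1'.symm i2, auxS, ← integral_const_mul,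
      intervalIntegral.integral_of_le zero_le_one, integral_Ioc_eq_integral_Ioo]
    congr 1
    funext t
    rw [mul_neg, Real.sin_neg, neg_sq]
    ring
  rw [Ek, Ek, ← mul_sub, ← integral_sub (aux_Ek_integrable l hl (-z)) (aux_Ek_integrable l hl z)]
  have e : ∀ t : ℝ, Complex.exp (Complex.I * (-z : ℝ) * (t : ℂ)) * (((1 + t) * (1 - t ^ 2) ^ (l - 1) : ℝ) : ℂ)
      - Complex.exp (Complex.I * z * (t : ℂ)) * (((1 + t) * (1 - t ^ 2) ^ (l - 1) : ℝ) : ℂ)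
      = -2 * Complex.I * ((Real.sin (z * t) * ((1 + t) * (1 - t ^ 2) ^ (l - 1)) : ℝ) : ℂ) := by
    intro t
    rw [← sub_mul, Complex.ofReal_mul (Real.sin (z * t)), ← mul_assoc]
    congr 1
    rw [Complex.ofReal_sin, Complex.sin]
    rw [show Complex.I * ((-z : ℝ) : ℂ) * t = -((z * t : ℝ) : ℂ) * Complex.I by push_cast; ring,
      show Complex.I * (z : ℂ) * t = ((z * t : ℝ) : ℂ) * Complex.I by push_cast; ring]
    linear_combination (Complex.exp (-((z * t : ℝ) : ℂ) * Complex.I) - Complex.exp (((z * t : ℝ) : ℂ) * Complex.I)) * Complex.I_sq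
  simp_rw [e]
  rw [integral_const_mul, integral_complex_ofReal, hS]
  push_cast
  ring

theorem aux_f_int (l y ξ : ℝ) (hl : 0 < l) (hy : 0 < y) (hξ : ξ ≠ 0) :
    IntegrableOn (fun x : ℝ => (((mLam l * x * (y ^ 2 + x ^ 2) ^ (-(l + 1)) * |x| ^ (2 * l) : ℝ)) : ℂ) *
            Ek l (Complex.I * (ξ * x : ℝ))) (Set.Ioi 0) := by
  have hc : Continuous (fun x : ℝ => (((mLam l * x * (y ^ 2 + x ^ 2) ^ (-(l + 1)) * |x| ^ (2 * l) : ℝ)) : ℂ) *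
            Ek l (Complex.I * (ξ * x : ℝ))) := by
    refine Continuous.mul (Complex.continuous_ofReal.comp ?_)
      ((aux_Ek_cont l hl).comp (by fun_prop : Continuous fun x : ℝ => ξ * x))
    refine Continuous.mul (Continuous.mul (by fun_prop) ?_) ?_
    · exact (by fun_prop : Continuous fun x : ℝ => y ^ 2 + x ^ 2).rpow_const (fun x => Or.inl (by positivity))
    · exact continuous_abs.rpow_const (fun x => Or.inr (by positivity))
  have hξ0 : 0 < |ξ| := abs_pos.2 hξ
  have hX : 0 < |ξ|⁻¹ := inv_pos.2 hξ0
  rw [← Set.Ioc_union_Ioi_eq_Ioi hX.le]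
  refine IntegrableOn.union ?_ ?_
  · exact (hc.integrableOn_Icc).mono_set Set.Ioc_subset_Icc_self
  obtain ⟨C, hC, hb⟩ := aux_Ek_decay l hl
  have hI : IntegrableOn (fun x : ℝ => |mLam l| * C * (|ξ| ^ (-(l / 3)) * x ^ (-1 + -(l / 3))
      + |ξ| ^ (-(1 / 3 : ℝ)) * x ^ (-1 + -(1 / 3 : ℝ)))) (Set.Ioi |ξ|⁻¹) := by
    refine Integrable.const_mul (Integrable.add (Integrable.const_mul ?_ _) (Integrable.const_mul ?_ _)) _
    · exact integrableOn_Ioi_rpow_of_lt (by linarith) hX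
    · exact integrableOn_Ioi_rpow_of_lt (by norm_num) hX
  refine Integrable.mono' hI hc.aestronglyMeasurable ?_
  filter_upwards [ae_restrict_mem measurableSet_Ioi] with x hx
  have hx1 : |ξ|⁻¹ < x := hx
  have hx0 : 0 < x := hX.trans hx1
  have hz : |ξ * x| = |ξ| * x := by rw [abs_mul, abs_of_pos hx0]
  have hz1 : 1 ≤ |ξ * x| := by
    rw [hz]
    have := mul_lt_mul_of_pos_left hx1 hξ0
    rw [mul_inv_cancel₀ hξ0.ne'] at this
    exact this.le
  have k1 := hb (ξ * x) hz1
  rw [hz, Real.mul_rpow hξ0.le hx0.le, Real.mul_rpow hξ0.le hx0.le] at k1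
  have hk : x * (y ^ 2 + x ^ 2) ^ (-(l + 1)) * |x| ^ (2 * l) ≤ x⁻¹ := by
    have : (y ^ 2 + x ^ 2) ^ (-(l + 1)) ≤ (x ^ 2) ^ (-(l + 1)) :=
      Real.rpow_le_rpow_of_nonpos (by positivity) (by nlinarith) (by linarith)
    have e : x * (x ^ 2) ^ (-(l + 1)) * |x| ^ (2 * l) = x⁻¹ := by
      rw [abs_of_pos hx0, ← Real.rpow_natCast x 2, ← Real.rpow_mul hx0.le, mul_assoc, ← Real.rpow_add hx0]
      rw [show ((2:ℕ):ℝ) * -(l + 1) + 2 * l = -(2:ℕ) by push_cast; ring, Real.rpow_neg hx0.le, Real.rpow_natCast]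
      field_simp
    rw [← e]
    gcongr
  rw [norm_mul, Complex.norm_real, Real.norm_eq_abs, mul_assoc, mul_assoc, abs_mul, ← mul_assoc x]
  have hk0 : 0 ≤ x * (y ^ 2 + x ^ 2) ^ (-(l + 1)) * |x| ^ (2 * l) := by positivity
  rw [abs_of_nonneg hk0]
  have hm := mul_le_mul_of_nonneg_left hk (abs_nonneg (mLam l))
  refine (mul_le_mul hm k1 (norm_nonneg _) (by positivity)).trans (le_of_eq ?_)
  rw [Real.rpow_add hx0, Real.rpow_add hx0, Real.rpow_neg_one]
  ring

theorem aux_stepA (l y ξ : ℝ) (hl : 0 < l) (hy : 0 < y) (hξ : 0 < ξ)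
    (hI : IntegrableOn (fun x : ℝ => x * (y ^ 2 + x ^ 2) ^ (-(l + 1)) * (x ^ (2 * l) * auxS l (ξ * x))) (Set.Ioi 0)) :
    ∫ x in Set.Ioi (0:ℝ), x * (y ^ 2 + x ^ 2) ^ (-(l + 1)) * (x ^ (2 * l) * auxS l (ξ * x))
      = Real.pi / (4 * l) * Real.exp (-(y * ξ)) := by
  let F : ℝ → ℝ → ℝ := fun x r => (x * (x ^ (2 * l) * auxS l (ξ * x))) * (2 * (l + 1) * r * (r ^ 2 + x ^ 2) ^ (-(l + 2)))
  have hSm : Measurable (auxS l) := (aux_S_cont l hl).measurable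
  have hFm : Measurable (Function.uncurry F) := by
    refine Measurable.mul (Measurable.mul (by fun_prop) (Measurable.mul (by fun_prop) ?_)) (by fun_prop)
    exact hSm.comp (by fun_prop)
  have hFi : Integrable (Function.uncurry F) ((volume.restrict (Set.Ioi (0:ℝ))).prod (volume.restrict (Set.Ioi y))) := by
    rw [integrable_prod_iff hFm.aestronglyMeasurable]
    constructor
    · refine Filter.Eventually.of_forall fun x => ?_
      exact (aux_outer l y x hl hy).1.const_mul (x * (x ^ (2 * l) * auxS l (ξ * x)))
    · refine IntegrableOn.congr_fun hI.norm (fun x hx => ?_) measurableSet_Ioi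
      have hx0 : (0:ℝ) < x := hx
      have e : ∀ r ∈ Set.Ioi y, ‖Function.uncurry F (x, r)‖ =
          ‖x * (x ^ (2 * l) * auxS l (ξ * x))‖ * (2 * (l + 1) * r * (r ^ 2 + x ^ 2) ^ (-(l + 2))) := by
        intro r hr
        have hr0 : 0 < r := lt_trans hy hr
        simp only [Function.uncurry, F]
        rw [norm_mul]
        congr 1
        exact Real.norm_of_nonneg (by positivity)
      rw [setIntegral_congr_fun measurableSet_Ioi e, integral_const_mul, (aux_outer l y x hl hy).2]
      have : 0 ≤ (y ^ 2 + x ^ 2) ^ (-(l + 1)) := by positivity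
      simp only [norm_mul, Real.norm_of_nonneg this]
      ring
  have hsw := integral_integral_swap hFi
  have hL : ∫ x in Set.Ioi (0:ℝ), ∫ r in Set.Ioi y, F x r =
      ∫ x in Set.Ioi (0:ℝ), x * (y ^ 2 + x ^ 2) ^ (-(l + 1)) * (x ^ (2 * l) * auxS l (ξ * x)) := by
    congr 1
    funext x
    simp only [F]
    rw [integral_const_mul, (aux_outer l y x hl hy).2]
    ring
  have hR : ∀ r ∈ Set.Ioi y, ∫ x in Set.Ioi (0:ℝ), F x r = Real.pi * ξ / (4 * l) * Real.exp (-ξ * r) := by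
    intro r hr
    have hr0 : 0 < r := lt_trans hy hr
    have h1 : ∀ x, F x r = 2 * (l + 1) * r * (x * (r ^ 2 + x ^ 2) ^ (-(l + 2)) * (x ^ (2 * l) * auxS l (ξ * x))) := by
      intro x; simp only [F]; ring
    simp_rw [h1]
    rw [integral_const_mul, aux_stepB l r ξ hl hr0, aux_sin r ξ hr0 hξ]
    have hl1 : l + 1 ≠ 0 := by positivity
    rw [show -(r * ξ) = -ξ * r by ring]
    field_simp
  rw [← hL, hsw, setIntegral_congr_fun measurableSet_Ioi hR, integral_const_mul,
    integral_exp_mul_Ioi (by linarith)]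
  rw [show -ξ * y = -(y * ξ) by ring]
  field_simp

/-- The Dunkl transform of the conjugate λ-Poisson kernel
`Q_y(x) = m_λ x (y²+x²)^{-(λ+1)}` is `(F_λ Q_y)(ξ) = −i sgn(ξ) e^{-y|ξ|}` for `ξ ≠ 0`:
`c_λ ∫_ℝ m_λ x (y²+x²)^{-(λ+1)} E_λ(-ixξ) |x|^{2λ} dx = −i sgn(ξ) e^{-y|ξ|}`. -/
theorem dunkl_transform_conjugate_poisson_kernel (l : ℝ) (hl : 0 < l) (y ξ : ℝ)
    (hy : 0 < y) (hξ : ξ ≠ 0) :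
    ((cLam l : ℝ) : ℂ) *
        ∫ x : ℝ,
          (((mLam l * x * (y ^ 2 + x ^ 2) ^ (-(l + 1)) * |x| ^ (2 * l) : ℝ)) : ℂ) *
            Ek l (-(Complex.I * (x : ℂ) * (ξ : ℂ)))
      = -Complex.I * ((Real.sign ξ : ℝ) : ℂ) * ((Real.exp (-(y * |ξ|)) : ℝ) : ℂ) := by
  have hG0 : 0 < Real.Gamma l := Real.Gamma_pos_of_pos hl
  have hG1 : 0 < Real.Gamma (l + 1 / 2) := Real.Gamma_pos_of_pos (by positivity)
  have hG2 : Real.Gamma (l + 1) = l * Real.Gamma l := Real.Gamma_add_one hl.ne'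
  have h2p : 0 < (2:ℝ) ^ (l + 1 / 2) := by positivity
  have hsq : 0 < Real.sqrt Real.pi := Real.sqrt_pos.2 Real.pi_pos
  have hss : Real.sqrt Real.pi * Real.sqrt Real.pi = Real.pi := Real.mul_self_sqrt Real.pi_pos.le
  have hconst : cLam l * (mLam l * cPrime l) = l / Real.pi := by
    rw [cLam, mLam, cPrime, hG2, Real.Gamma_one_half_eq]
    field_simp
    rw [Real.sq_sqrt Real.pi_pos.le]
  have hmc : mLam l * cPrime l ≠ 0 := by
    intro h
    rw [h, mul_zero] at hconst
    exact (div_pos hl Real.pi_pos).ne hconst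
  set f : ℝ → ℂ := fun x => (((mLam l * x * (y ^ 2 + x ^ 2) ^ (-(l + 1)) * |x| ^ (2 * l) : ℝ)) : ℂ) *
            Ek l (-(Complex.I * (x : ℂ) * (ξ : ℂ))) with hf
  have ef : ∀ x, f x = (((mLam l * x * (y ^ 2 + x ^ 2) ^ (-(l + 1)) * |x| ^ (2 * l) : ℝ)) : ℂ) *
            Ek l (Complex.I * (-ξ * x : ℝ)) := by
    intro x
    simp only [f]
    congr 2
    push_cast; ring
  have efn : ∀ x, f (-x) = -((((mLam l * x * (y ^ 2 + x ^ 2) ^ (-(l + 1)) * |x| ^ (2 * l) : ℝ)) : ℂ) *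
            Ek l (Complex.I * (ξ * x : ℝ))) := by
    intro x
    rw [ef, abs_neg, neg_sq, neg_mul_neg]
    push_cast
    ring
  have i1 : IntegrableOn f (Set.Ioi 0) := by
    rw [show f = _ from funext ef]
    exact aux_f_int l y (-ξ) hl hy (neg_ne_zero.2 hξ)
  have i2 : IntegrableOn (fun x => f (-x)) (Set.Ioi 0) := by
    rw [show (fun x => f (-x)) = _ from funext efn]
    exact (aux_f_int l y ξ hl hy hξ).neg
  have hsg : Real.sign ξ ≠ 0 := by rwa [Ne, Real.sign_eq_zero_iff]
  have hSs : ∀ x, auxS l (ξ * x) = Real.sign ξ * auxS l (|ξ| * x) := by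
    intro x
    rcases lt_or_gt_of_ne hξ with h | h
    · rw [Real.sign_of_neg h, abs_of_neg h, neg_mul ξ x, aux_S_neg]; ring
    · rw [Real.sign_of_pos h, abs_of_pos h, one_mul]
  let c : ℂ := -4 * Complex.I * ((mLam l * cPrime l : ℝ) : ℂ) * ((Real.sign ξ : ℝ) : ℂ)
  have hc0 : c ≠ 0 := by
    simp only [c]
    refine mul_ne_zero (mul_ne_zero (by simp) ?_) ?_
    · exact_mod_cast hmc
    · exact_mod_cast hsg
  let k : ℝ → ℝ := fun x => x * (y ^ 2 + x ^ 2) ^ (-(l + 1)) * (x ^ (2 * l) * auxS l (|ξ| * x))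
  have esum : ∀ x ∈ Set.Ioi (0:ℝ), f x + f (-x) = c * (k x : ℂ) := by
    intro x hx
    have hx0 : (0:ℝ) < x := hx
    rw [ef, efn, ← sub_eq_add_neg, ← mul_sub, neg_mul, aux_Ek_diff l (ξ * x) hl, hSs, abs_of_pos hx0]
    simp only [c, k]
    push_cast
    ring
  have hks : IntegrableOn k (Set.Ioi 0) := by
    have h1 : IntegrableOn (fun x => c * (k x : ℂ)) (Set.Ioi 0) :=
      IntegrableOn.congr_fun (i1.add i2) esum measurableSet_Ioi
    have h2 := (h1.const_mul c⁻¹).re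
    refine IntegrableOn.congr_fun h2 (fun x _ => ?_) measurableSet_Ioi
    rw [inv_mul_cancel_left₀ hc0]
    simp
  rw [(aux_integral_split i1 i2).2, setIntegral_congr_fun measurableSet_Ioi esum, integral_const_mul,
    integral_complex_ofReal, aux_stepA l y |ξ| hl hy (abs_pos.2 hξ) hks]
  have h4 : (cLam l : ℂ) * ((mLam l * cPrime l : ℝ) : ℂ) * ((Real.pi / (4 * l) : ℝ) : ℂ) = 1 / 4 := by
    have h5 : cLam l * (mLam l * cPrime l) * (Real.pi / (4 * l)) = 1 / 4 := by
      rw [hconst]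
      have := Real.pi_pos
      field_simp
    have h6 := congrArg (fun a : ℝ => (a : ℂ)) h5
    rw [Complex.ofReal_mul, Complex.ofReal_mul] at h6
    rw [h6]; norm_num
  rw [Complex.ofReal_mul (Real.pi / (4 * l))]
  simp only [c]
  linear_combination (-4 * Complex.I * ((Real.sign ξ : ℝ) : ℂ) * ((Real.exp (-(y * |ξ|)) : ℝ) : ℂ)) * h4
end
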